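/- There is no witness Gabriel drawing of K_{3,3,3,3}: there do not exist a finite set P ⊆ ℝ² of 12 points, a finite set W ⊆ ℝ² with P ∪ W in general position, and a coloring c : P → Fin 4 with every color class of size 3, such that distinct a, b ∈ P are adjacent in GG⁻(P,W) if and only if c(a) ≠ c(b). -/

import Mathlib

open scoped RealInnerProductSpace

noncomputable section

/-- The Euclidean plane. -/
abbrev Pt := EuclideanSpace ℝ (Fin 2)

/-- The closed disk with diameter `ab`. -/
def diskD (a b : Pt) : Set Pt := Metric.closedBall (midpoint ℝ a b) (dist a b / 2)

/-- `a` and `b` are adjacent in the witness Gabriel graph with witness set `W`. -/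
def gabrielEdge (W : Set Pt) (a b : Pt) : Prop := (diskD a b \ {a, b}) ∩ W = ∅

/-- General position: no three points collinear, no four points concyclic. -/
def GenPos (S : Set Pt) : Prop :=
  (∀ a ∈ S, ∀ b ∈ S, ∀ c ∈ S, a ≠ b → a ≠ c → b ≠ c → ¬ Collinear ℝ ({a, b, c} : Set Pt)) ∧
  (∀ a ∈ S, ∀ b ∈ S, ∀ c ∈ S, ∀ d ∈ S, a ≠ b → a ≠ c → a ≠ d → b ≠ c → b ≠ d → c ≠ d →
    ¬ EuclideanGeometry.Cospherical ({a, b, c, d} : Set Pt))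

/-- Planar determinant `u₁v₂ − u₂v₁`. -/
def det2 (u v : Pt) : ℝ := u 0 * v 1 - u 1 * v 0

/-- Counterclockwise convex position. -/
def CCWConvexPos {m : ℕ} (q : Fin m → Pt) : Prop :=
  ∀ i j k : Fin m, i < j → j < k → 0 < det2 (q j - q i) (q k - q i)

/-- Cyclic successor in `Fin m`. -/
def cyclicSucc {m : ℕ} (hm : 0 < m) (i : Fin m) : Fin m :=
  ⟨((i : ℕ) + 1) % m, Nat.mod_lt _ hm⟩

namespace KW
abbrev R2 := ℝ × ℝ
def O (a b c : R2) : ℝ := (b.1-a.1)*(c.2-a.2)-(b.2-a.2)*(c.1-a.1)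
def dt (w x y : R2) : ℝ := (x.1-w.1)*(y.1-w.1)+(x.2-w.2)*(y.2-w.2)

lemma O_rot (a b c : R2) : O b c a = O a b c := by unfold O; ring
lemma O_rot2 (a b c : R2) : O c a b = O a b c := by unfold O; ring
lemma O_sw (a b c : R2) : O a c b = - O a b c := by unfold O; ring
lemma O_sw' (a b c : R2) : O b a c = - O a b c := by unfold O; ring
lemma O_sw3 (a b c : R2) : O c b a = - O a b c := by unfold O; ring
@[simp] lemma O_aa (a b : R2) : O a a b = 0 := by unfold O; ring
@[simp] lemma O_ab (a b : R2) : O a b a = 0 := by unfold O; ring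
@[simp] lemma O_bb (a b : R2) : O a b b = 0 := by unfold O; ring
lemma dt_comm (a b c : R2) : dt a c b = dt a b c := by unfold dt; ring

lemma lag (w p q b : R2) : dt w p p * dt w b q = dt w p b * dt w p q + O w p b * O w p q := by
  unfold O dt; ring

lemma dt_self_nonneg (w p : R2) : 0 ≤ dt w p p := add_nonneg (mul_self_nonneg _) (mul_self_nonneg _)
lemma dt_self_pos {w p : R2} (h : p ≠ w) : 0 < dt w p p := by
  rcases lt_or_eq_of_le (dt_self_nonneg w p) with h1 | h1
  · exact h1
  · exfalso; apply h
    unfold dt at h1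
    ext
    · nlinarith [mul_self_nonneg (p.1-w.1), mul_self_nonneg (p.2-w.2)]
    · nlinarith [mul_self_nonneg (p.1-w.1), mul_self_nonneg (p.2-w.2)]

/-- barycentric identities -/
lemma bary (z b c q u v : R2) :
    O z b c * O u v q = O q b c * O u v z + O z q c * O u v b + O z b q * O u v c := by
  unfold O; ring
lemma baryd (z b c q w p : R2) :
    O z b c * dt w q p = O q b c * dt w z p + O z q c * dt w b p + O z b q * dt w c p := by
  unfold O dt; ring
lemma bsum (z b c q : R2) : O z b c = O q b c + O z q c + O z b q := by
  unfold O; ring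

/-- strict perpendicular cone implies inside the angle -/
lemma cone_in {w p q b : R2} (h0 : 0 < O w p q) (h1 : dt w p q ≤ 0) (h2 : 0 < dt w b p)
    (h3 : 0 < dt w b q) : 0 < O w p b ∧ 0 < O w b q := by
  have hp : p ≠ w := by rintro rfl; simp at h0
  have hq : q ≠ w := by rintro rfl; simp at h0
  have := dt_self_pos hp
  have := dt_self_pos hq
  constructor
  · have e := lag w p q b
    rw [dt_comm w b p] at e
    have : 0 < O w p b * O w p q := by nlinarith
    exact pos_of_mul_pos_left this h0.le
  · have e := lag w q p b
    rw [dt_comm w b q, dt_comm w p q, O_sw w b q, O_sw w p q] at e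
    have : 0 < O w b q * O w p q := by nlinarith
    exact pos_of_mul_pos_left this h0.le

/-- acute cone -/
lemma cone_acute {w p q x y : R2} (h0 : O w p q ≠ 0) (h1 : dt w p q ≤ 0) (h2 : 0 < dt w x p)
    (h3 : 0 < dt w x q) (h4 : 0 < dt w y p) (h5 : 0 < dt w y q) : 0 < dt w x y := by
  wlog H : 0 < O w p q generalizing p q
  · refine this (p := q) (q := p) ?_ ?_ h3 h2 h5 h4 ?_
    · rw [O_sw]; simpa using h0
    · rw [dt_comm]; exact h1
    · rw [O_sw]; rcases lt_or_gt_of_ne h0 with h | h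
      · linarith
      · exact absurd h H
  obtain ⟨a, b⟩ := cone_in H h1 h2 h3
  have e := baryd w p q x w y
  have z : dt w w y = 0 := by unfold dt; ring
  rw [z, dt_comm w y p, dt_comm w y q] at e
  have : 0 < O w p q * dt w x y := by rw [e]; nlinarith [mul_pos a h5, mul_pos b h4]
  exact pos_of_mul_pos_right this H.le

lemma fa_ne {a b c : R2} (h1 : 0 < dt a b c) (h2 : 0 < dt b a c) (h3 : 0 < dt c a b) : O a b c ≠ 0 := by
  intro h
  have e : O a b c ^ 2 = dt a b c * dt b a c + dt b a c * dt c a b + dt c a b * dt a b c := by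
    unfold O dt; ring
  rw [h] at e
  nlinarith [mul_pos h1 h2, mul_pos h2 h3, mul_pos h3 h1]
lemma fa_arg {x1 y1 x2 y2 x3 y3 : ℝ} (h1 : 0 < x1) (h2 : 0 < y1) (h3 : 0 < x2) (h4 : 0 < y2)
   (h6 : 0 < y3) (e : (x1*x2-y1*y2)*y3 + (x1*y2+y1*x2)*x3 = 0)
   (e2 : 0 ≤ (x1*x2-y1*y2)*x3 - (x1*y2+y1*x2)*y3) : False := by
  have k : 0 < x1*y2+y1*x2 := by positivity
  generalize x1*x2-y1*y2 = m at *
  generalize x1*y2+y1*x2 = n at *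
  have e3 : y3*(m*x3-n*y3) = -(n*(x3^2+y3^2)) := by linear_combination x3*e
  have : 0 ≤ y3*(m*x3-n*y3) := mul_nonneg h6.le e2
  have : 0 < n*(x3^2+y3^2) := by positivity
  linarith
lemma fa_in {a b c d : R2} (o1 : 0 < O a b d) (o2 : 0 < O b c d) (o3 : 0 < O c a d)
   (d1 : 0 < dt d a b) (d2 : 0 < dt d b c) (_d3 : 0 < dt d c a) : False := by
  refine fa_arg (x1 := dt d a b) (y1 := O a b d) (x2 := dt d b c) (y2 := O b c d) (x3 := dt d c a) (y3 := O c a d)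
    d1 o1 d2 o2 o3 ?_ ?_
  · unfold dt O; ring
  · have : (dt d a b * dt d b c - O a b d * O b c d) * dt d c a - (dt d a b * O b c d + O a b d * dt d b c) * O c a d
      = dt d a a * dt d b b * dt d c c := by unfold dt O; ring
    rw [this]
    exact mul_nonneg (mul_nonneg (dt_self_nonneg _ _) (dt_self_nonneg _ _)) (dt_self_nonneg _ _)
lemma fa_cv {a b c d : R2} (o1 : 0 < O a b d) (o2 : 0 < O b c a) (o3 : 0 < O c d b) (o4 : 0 < O d a c)
   (d1 : 0 < dt a b d) (d2 : 0 < dt b c a) (d3 : 0 < dt c d b) (d4 : 0 < dt d a c) : False := by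
  refine fa_arg (x1 := dt a b d) (y1 := O a b d) (x2 := dt b c a) (y2 := O b c a)
    (x3 := dt c d b * dt d a c - O c d b * O d a c) (y3 := dt c d b * O d a c + O c d b * dt d a c)
    d1 o1 d2 o2 (by positivity) ?_ ?_
  · unfold dt O; ring
  · have : (dt a b d * dt b c a - O a b d * O b c a) * (dt c d b * dt d a c - O c d b * O d a c)
       - (dt a b d * O b c a + O a b d * dt b c a) * (dt c d b * O d a c + O c d b * dt d a c)
      = dt a b b * dt b c c * (dt c d d * dt d a a) := by unfold dt O; ring
    rw [this]
    exact mul_nonneg (mul_nonneg (dt_self_nonneg _ _) (dt_self_nonneg _ _)) (mul_nonneg (dt_self_nonneg _ _) (dt_self_nonneg _ _))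

lemma four_acute0 (a b c d : R2) (a1 : 0 < dt a b c) (a2 : 0 < dt a c d) (a3 : 0 < dt a b d)
   (b1 : 0 < dt b a c) (b2 : 0 < dt b c d) (b3 : 0 < dt b a d)
   (c1 : 0 < dt c a b) (c2 : 0 < dt c b d) (c3 : 0 < dt c a d)
   (d1 : 0 < dt d a b) (d2 : 0 < dt d b c) (d3 : 0 < dt d a c) (H : 0 < O a b c) : False := by
  have e : O a b c = O a b d + O b c d - O a c d := by unfold O; ring
  have t (x y z : R2) (h : 0 < dt x y z) : 0 < dt x z y := by rwa [dt_comm]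
  rcases lt_or_gt_of_ne (fa_ne a3 b3 d1) with k1 | k1 <;> rcases lt_or_gt_of_ne (fa_ne a2 c3 d3) with k2 | k2 <;>
    rcases lt_or_gt_of_ne (fa_ne b2 c2 d2) with k3 | k3
  · exact fa_in (a := a) (b := d) (c := c) (d := b) (by unfold O at *; linarith) (by unfold O at *; linarith) (by unfold O at *; linarith) b3 (t _ _ _ b2) (t _ _ _ b1)
  · exact fa_cv (a := a) (b := d) (c := b) (d := c) (by unfold O at *; linarith) (by unfold O at *; linarith) (by unfold O at *; linarith) (by unfold O at *; linarith)
      (t _ _ _ a2) (t _ _ _ d1) b2 c1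
  · linarith
  · exact fa_in (a := b) (b := c) (c := d) (d := a) (by unfold O at *; linarith) (by unfold O at *; linarith) (by unfold O at *; linarith) a1 a2 (t _ _ _ a3)
  · exact fa_cv (a := a) (b := b) (c := d) (d := c) H (by unfold O at *; linarith) (by unfold O at *; linarith) (by unfold O at *; linarith)
      a1 (t _ _ _ b3) (t _ _ _ d2) c3
  · exact fa_in (a := a) (b := b) (c := c) (d := d) k1 k3 (by unfold O at *; linarith) d1 d2 (t _ _ _ d3)
  · exact fa_in (a := a) (b := b) (c := d) (d := c) H (by unfold O at *; linarith) (by unfold O at *; linarith) c1 c2 (t _ _ _ c3)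
  · exact fa_cv (a := a) (b := b) (c := c) (d := d) k1 (by unfold O at *; linarith) (by unfold O at *; linarith) (by unfold O at *; linarith)
     a3 (t _ _ _ b1) (t _ _ _ c2) d3
lemma four_acute (a b c d : R2) (a1 : 0 < dt a b c) (a2 : 0 < dt a c d) (a3 : 0 < dt a b d)
   (b1 : 0 < dt b a c) (b2 : 0 < dt b c d) (b3 : 0 < dt b a d)
   (c1 : 0 < dt c a b) (c2 : 0 < dt c b d) (c3 : 0 < dt c a d)
   (d1 : 0 < dt d a b) (d2 : 0 < dt d b c) (d3 : 0 < dt d a c) : False := by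
  rcases lt_or_gt_of_ne (fa_ne a1 b1 c1) with k | k
  · have t (x y z : R2) (h : 0 < dt x y z) : 0 < dt x z y := by rwa [dt_comm]
    exact four_acute0 a c b d (t _ _ _ a1) a3 a2 c1 c2 c3 b1 b2 b3 d3 (t _ _ _ d2) d1 (by rw [O_sw]; linarith)
  · exact four_acute0 a b c d a1 a2 a3 b1 b2 b3 c1 c2 c3 d1 d2 d3 k

structure PW (w p q b c : R2) : Prop where
  hpq : dt w p q ≤ 0
  hO : O w p q ≠ 0
  hb : b = w ∨ (0 < dt w b p ∧ 0 < dt w b q)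
  hc : c = w ∨ (0 < dt w c p ∧ 0 < dt w c q)

structure PP (p q w b c z : R2) : Prop where
  h1 : PW w p q b c
  h2 : PW z b c p q
  g1 : O p q b ≠ 0
  g2 : O p q c ≠ 0
  g3 : O b c p ≠ 0
  g4 : O b c q ≠ 0

lemma PP.symm {p q w b c z : R2} (h : PP p q w b c z) : PP b c z p q w :=
  ⟨h.h2, h.h1, h.g3, h.g4, h.g1, h.g2⟩
lemma PP.sw1 {p q w b c z : R2} (h : PP p q w b c z) : PP q p w b c z := by
  obtain ⟨⟨a1,a2,a3,a4⟩,⟨b1,b2,b3,b4⟩,g1,g2,g3,g4⟩ := h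
  refine ⟨⟨by rwa [dt_comm], by rw [O_sw]; simpa using a2, by tauto, by tauto⟩, ⟨b1,b2,b4,b3⟩, ?_, ?_, g4, g3⟩
  · rw [O_sw']; simpa using g1
  · rw [O_sw']; simpa using g2
lemma PP.sw2 {p q w b c z : R2} (h : PP p q w b c z) : PP p q w c b z := h.symm.sw1.symm

lemma PP.cone {p q w b c z : R2} (h : PP p q w b c z) (H : 0 < O w p q) :
   b = w ∨ (0 < O w p b ∧ 0 < O w b q) := by
  rcases h.h1.hb with h1 | ⟨h1, h2⟩
  · exact Or.inl h1
  · exact Or.inr (cone_in H h.h1.hpq h1 h2)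
lemma PP.cone' {p q w b c z : R2} (h : PP p q w b c z) (H : 0 < O w p q) :
   0 ≤ O w p b ∧ 0 ≤ O w b q := by
  rcases h.cone H with h1 | ⟨h1, h2⟩
  · subst h1; simp
  · exact ⟨h1.le, h2.le⟩

/-- orientation normal form induction -/
lemma PP.pos {p q w b c z : R2} (h : PP p q w b c z) : 0 < O w p q ∨ 0 < O w q p := by
  rcases lt_or_gt_of_ne h.h1.hO with h | h
  · right; rw [O_sw]; linarith
  · left; exact h

lemma crossId (p q b c u v : R2) :
   O b c q * O u v p - O b c p * O u v q = O p q b * O u v c - O p q c * O u v b := by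
  unfold O; ring

lemma sep0 {p q w b c z : R2} (h : PP p q w b c z) (H : 0 < O w p q) (hx : O p q b * O p q c < 0) :
   O b c p * O b c q < 0 := by
  obtain ⟨x1, x2⟩ := h.cone' H
  obtain ⟨y1, y2⟩ := h.sw2.cone' H
  have e1 := crossId p q b c w p
  have e2 := crossId p q b c q w
  simp only [O_bb, O_ab] at e1 e2
  have i1 : O q w p = O w p q := by unfold O; ring
  have i2 : O q w b = O w b q := by unfold O; ring
  have i3 : O q w c = O w c q := by unfold O; ring
  rw [i1, i2, i3] at e2
  rcases lt_or_gt_of_ne h.g1 with k | k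
  · have k2 : 0 < O p q c := by nlinarith
    have : 0 ≤ O b c p := by
      by_contra hh; push Not at hh; nlinarith [mul_nonneg x1 k2.le, mul_nonneg y1 (neg_nonneg.2 k.le)]
    have : O b c q ≤ 0 := by
      by_contra hh; push Not at hh; nlinarith [mul_nonneg x2 k2.le, mul_nonneg y2 (neg_nonneg.2 k.le)]
    have := lt_of_le_of_ne this h.g4
    have := lt_of_le_of_ne ‹0 ≤ O b c p› h.g3.symm
    nlinarith
  · have k2 : O p q c < 0 := by nlinarith
    have : O b c p ≤ 0 := by
      by_contra hh; push Not at hh; nlinarith [mul_nonneg y1 k.le, mul_nonneg x1 (neg_nonneg.2 k2.le)]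
    have : 0 ≤ O b c q := by
      by_contra hh; push Not at hh; nlinarith [mul_nonneg y2 k.le, mul_nonneg x2 (neg_nonneg.2 k2.le)]
    have := lt_of_le_of_ne this h.g4.symm
    have := lt_of_le_of_ne ‹O b c p ≤ 0› h.g3
    nlinarith
lemma sep {p q w b c z : R2} (h : PP p q w b c z) (hx : O p q b * O p q c < 0) :
   O b c p * O b c q < 0 := by
  rcases h.pos with H | H
  · exact sep0 h H hx
  · have := sep0 h.sw1 H (by rw [O_sw' p q, O_sw' p q]; linarith)
    linarith
lemma sep_iff {p q w b c z : R2} (h : PP p q w b c z) : O p q b * O p q c < 0 ↔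
   O b c p * O b c q < 0 := ⟨sep h, sep h.symm⟩

lemma nsep {p q w b c z : R2} (h : PP p q w b c z) (hx : 0 < O p q b * O p q c) :
   0 < O b c p * O b c q := by
  have := (sep_iff h).not.1 (by linarith)
  have := mul_ne_zero h.g3 h.g4
  exact lt_of_le_of_ne (by linarith) this.symm

lemma N0 {p q w b c z : R2} (h : PP p q w b c z) (hx : 0 < O p q b * O p q c) : b ≠ w := by
  wlog H : 0 < O w p q generalizing p q
  · refine this h.sw1 (by rw [O_sw' p q, O_sw' p q]; linarith) ?_
    rcases h.pos with h | h
    · exact absurd h H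
    · exact h
  have hy := nsep h hx
  intro hb
  rcases h.sw2.cone H with h1 | ⟨h1, h2⟩
  · apply h.g3; rw [hb, h1]; simp
  · subst hb
    rw [O_sw b p c] at hy
    nlinarith

lemma N0' {p q w b c z : R2} (h : PP p q w b c z) (hx : 0 < O p q b * O p q c) :
  (b ≠ w ∧ c ≠ w) ∧ (p ≠ z ∧ q ≠ z) :=
  ⟨⟨N0 h hx, N0 h.sw2 (by linarith)⟩, N0 h.symm (nsep h hx), N0 h.symm.sw2 (by linarith [nsep h hx])⟩

lemma N1a {p q w b c z : R2} (h : PP p q w b c z) (hx : 0 < O p q b * O p q c)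
   (H : 0 < O w p q) (H2 : 0 < O z b c) : 0 < dt w z p := by
  obtain ⟨⟨n1, n2⟩, n3, n4⟩ := N0' h hx
  have hy := nsep h hx
  obtain ⟨b1, b2⟩ := (h.cone H).resolve_left n1
  obtain ⟨c1, c2⟩ := (h.sw2.cone H).resolve_left n2
  obtain ⟨p1, p2⟩ := (h.symm.cone H2).resolve_left n3
  obtain ⟨q1, q2⟩ := (h.symm.sw2.cone H2).resolve_left n4
  have db := h.h1.hb.resolve_left n1
  have dc := h.h1.hc.resolve_left n2
  by_contra hz; push Not at hz
  have e := baryd z b c q w p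
  rw [dt_comm w p q] at e
  have hq : 0 < O q b c := by
    by_contra hh; push Not at hh
    nlinarith [mul_pos q2 db.1, mul_pos q1 dc.1, mul_nonneg (neg_nonneg.2 hh) (neg_nonneg.2 hz), mul_nonneg H2.le (neg_nonneg.2 h.h1.hpq)]
  have hq' : 0 < O b c q := by rw [← O_rot2] at hq; rw [← O_rot2]; exact (by unfold O at *; linarith)
  have hp' : 0 < O b c p := pos_of_mul_pos_left hy hq'.le
  have hp : 0 < O p b c := by unfold O at *; linarith
  have e2 := bary z b c p w p
  simp only [O_bb] at e2
  have hF : O w p z < 0 := by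
    by_contra hh; push Not at hh
    nlinarith [mul_pos p1 c1, mul_pos p2 b1, mul_nonneg hp.le hh]
  have hpw : p ≠ w := by rintro rfl; simp at H
  have key : dt w p p * dt z b c = (dt w b p - dt w z p) * (dt w c p - dt w z p) +
     (O w p b - O w p z) * (O w p c - O w p z) := by unfold dt O; ring
  have h1 : 0 < dt w p p * dt z b c := by
    rw [key]
    have : 0 < (dt w b p - dt w z p) * (dt w c p - dt w z p) := mul_pos (by linarith [db.1]) (by linarith [dc.1])
    have : 0 < (O w p b - O w p z) * (O w p c - O w p z) := mul_pos (by linarith) (by linarith)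
    linarith
  have := pos_of_mul_pos_right h1 (dt_self_nonneg w p)
  linarith [h.h2.hpq]
lemma nx1 {p q b c : R2} (hx : 0 < O p q b * O p q c) : 0 < O q p b * O q p c := by
  rw [O_sw' p q, O_sw' p q]; linarith
lemma nx2 {p q b c : R2} (hx : 0 < O p q b * O p q c) : 0 < O p q c * O p q b := by linarith

/-- reflection -/
def rf (x : R2) : R2 := (x.1, -x.2)
lemma O_rf (a b c : R2) : O (rf a) (rf b) (rf c) = - O a b c := by unfold O rf; ring
lemma dt_rf (a b c : R2) : dt (rf a) (rf b) (rf c) = dt a b c := by unfold dt rf; ring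
lemma PP.rfl {p q w b c z : R2} (h : PP p q w b c z) : PP (rf p) (rf q) (rf w) (rf b) (rf c) (rf z) := by
  obtain ⟨⟨a1,a2,a3,a4⟩,⟨b1,b2,b3,b4⟩,g1,g2,g3,g4⟩ := h
  have i (x y : R2) (P : Prop) (h : x = y ∨ P) : rf x = rf y ∨ P := by
    rcases h with h | h
    · left; rw [h]
    · right; exact h
  constructor
  · constructor <;> simp only [O_rf, dt_rf]
    · exact a1
    · simpa using a2
    · exact i _ _ _ a3
    · exact i _ _ _ a4
  · constructor <;> simp only [O_rf, dt_rf]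
    · exact b1
    · simpa using b2
    · exact i _ _ _ b3
    · exact i _ _ _ b4
  all_goals simp only [O_rf]; simpa

lemma N1b {p q w b c z : R2} (h : PP p q w b c z) (hx : 0 < O p q b * O p q c)
   (H : 0 < O w p q) : 0 < dt w z p := by
  rcases h.symm.pos with k | k
  · exact N1a h hx H k
  · exact N1a h.sw2 (nx2 hx) H k
lemma N1 {p q w b c z : R2} (h : PP p q w b c z) (hx : 0 < O p q b * O p q c) : 0 < dt w z p := by
  rcases h.pos with k | k
  · exact N1b h hx k
  · have := N1b h.rfl (by simp only [O_rf]; linarith) (by rw [O_rf]; rw [O_sw] at k; linarith)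
    rwa [dt_rf] at this
lemma N1' {p q w b c z : R2} (h : PP p q w b c z) (hx : 0 < O p q b * O p q c) : 0 < dt w z q :=
  N1 h.sw1 (nx1 hx)

lemma tri {w p q x : R2} (H : 0 < O w p q) (h : dt w p q ≤ 0) (x1 : 0 < O w p x) (x2 : 0 < O w x q)
    (x3 : 0 ≤ O p q x) : dt x p q < 0 := by
  have e : O w p q * O w p q * dt x p q = - (O w x q * (O w p x + O p q x) * dt w p p)
      - O w p x * (O w x q + O p q x) * dt w q q
      + ((O w p x + O p q x) * (O w x q + O p q x) + O w x q * O w p x) * dt w p q := by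
    unfold O dt; ring
  have hp : p ≠ w := by rintro rfl; simp at H
  have hq : q ≠ w := by rintro rfl; simp at H
  have := dt_self_pos hp
  have := dt_self_pos hq
  have k1 : 0 < O w x q * (O w p x + O p q x) * dt w p p := by positivity
  have k2 : 0 < O w p x * (O w x q + O p q x) * dt w q q := by positivity
  have k3 : 0 < ((O w p x + O p q x) * (O w x q + O p q x) + O w x q * O w p x) := by positivity
  have : O w p q * O w p q * dt x p q < 0 := by rw [e]; nlinarith
  by_contra hh; push Not at hh
  have : 0 ≤ O w p q * O w p q * dt x p q := by positivity
  linarith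

lemma N2a {p q w b c z : R2} (h : PP p q w b c z) (hx : 0 < O p q b * O p q c)
   (H : 0 < O w p q) (H2 : 0 < O z b c) : O p q b < 0 := by
  obtain ⟨⟨n1, n2⟩, n3, n4⟩ := N0' h hx
  have hy := nsep h hx
  obtain ⟨b1, b2⟩ := (h.cone H).resolve_left n1
  obtain ⟨c1, c2⟩ := (h.sw2.cone H).resolve_left n2
  obtain ⟨p1, p2⟩ := (h.symm.cone H2).resolve_left n3
  obtain ⟨q1, q2⟩ := (h.symm.sw2.cone H2).resolve_left n4
  have db := h.h1.hb.resolve_left n1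
  have dc := h.h1.hc.resolve_left n2
  have dp := h.h2.hb.resolve_left n3
  have dq := h.h2.hc.resolve_left n4
  by_contra hb; push Not at hb
  have hb : 0 < O p q b := lt_of_le_of_ne hb h.g1.symm
  have hc : 0 < O p q c := pos_of_mul_pos_right hx hb.le
  have zpq := cone_acute h.h2.hO h.h2.hpq dp.1 dp.2 dq.1 dq.2
  obtain ⟨z1, z2⟩ := cone_in H h.h1.hpq (N1 h hx) (N1' h hx)
  by_cases hz : 0 ≤ O p q z
  · have := tri H h.h1.hpq z1 z2 hz
    linarith
  push Not at hz
  have t1 := tri H h.h1.hpq b1 b2 hb.le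
  have t2 := tri H h.h1.hpq c1 c2 hc.le
  rcases lt_or_gt_of_ne h.g3 with k | k
  · have e := bary z b c p p q
    simp only [O_ab] at e
    have i : O p b c = O b c p := by unfold O; ring
    rw [i] at e
    nlinarith [mul_pos (neg_pos.2 k) (neg_pos.2 hz), mul_pos p2 hb, mul_pos p1 hc]
  · have k2 : 0 < O b c q := pos_of_mul_pos_right hy k.le
    have t3 := tri H2 h.h2.hpq p1 p2 k.le
    have t4 := tri H2 h.h2.hpq q1 q2 k2.le
    have e : dt b p q + dt q b c + dt c p q + dt p b c = ((b.1-p.1)+(c.1-q.1))^2 + ((b.2-p.2)+(c.2-q.2))^2 := by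
      unfold dt; ring
    have : 0 ≤ ((b.1-p.1)+(c.1-q.1))^2 + ((b.2-p.2)+(c.2-q.2))^2 := by positivity
    linarith
lemma N2b {p q w b c z : R2} (h : PP p q w b c z) (hx : 0 < O p q b * O p q c)
   (H : 0 < O w p q) : O p q b < 0 := by
  rcases h.symm.pos with k | k
  · exact N2a h hx H k
  · have := N2a h.sw2 (nx2 hx) H k
    nlinarith
lemma N2 {p q w b c z : R2} (h : PP p q w b c z) (hx : 0 < O p q b * O p q c) : O p q b * O p q w < 0 := by
  rw [O_rot w p q]
  rcases h.pos with k | k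
  · exact mul_neg_of_neg_of_pos (N2b h hx k) k
  · have := N2b h.rfl (by simp only [O_rf]; linarith) (by rw [O_rf]; rw [O_sw] at k; linarith)
    rw [O_rf] at this
    rw [O_sw] at k
    exact mul_neg_of_pos_of_neg (by linarith) (by linarith)

/-- crossing: apex position -/
lemma Xa {p q w b c z : R2} (h : PP p q w b c z) (H : 0 < O w p q) (H2 : 0 < O z b c)
    (hc : O p q c < 0) (hp : 0 < O b c p) : z = p ∨ O w p z < 0 := by
  by_cases n3 : p = z
  · exact Or.inl n3.symm
  right
  obtain ⟨b1, b2⟩ := h.cone' H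
  have c1 : 0 < O w p c := by
    rcases h.sw2.cone H with k | k
    · subst k; exact absurd hc (by rw [O_rot]; linarith)
    · exact k.1
  obtain ⟨p1, p2⟩ := (h.symm.cone H2).resolve_left n3
  have e := bary z b c p w p
  simp only [O_bb] at e
  have i : O p b c = O b c p := by unfold O; ring
  rw [i] at e
  by_contra hh; push Not at hh
  nlinarith [mul_nonneg hp.le hh, mul_nonneg p2.le b1, mul_pos p1 c1]
lemma Xb {p q w b c z : R2} (h : PP p q w b c z) (H : 0 < O w p q)
    (hc : O p q c < 0) (hp : 0 < O b c p * O b c z) : z = p ∨ O w p z < 0 := by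
  rcases h.symm.pos with k | k
  · exact Xa h H k hc (by rw [O_rot z] at hp; exact pos_of_mul_pos_left hp k.le)
  · -- mirrored roles of b and c
    by_cases n3 : p = z
    · exact Or.inl n3.symm
    right
    obtain ⟨b1, b2⟩ := h.cone' H
    have c1 : 0 < O w p c := by
      rcases h.sw2.cone H with k | k
      · subst k; exact absurd hc (by rw [O_rot]; linarith)
      · exact k.1
    obtain ⟨p1, p2⟩ := (h.sw2.symm.cone k).resolve_left n3
    have e := bary z c b p w p
    simp only [O_bb] at e
    have hp' : 0 < O p c b := by
      have i1 : O p c b = - O b c p := by unfold O; ring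
      have i2 : O b c z = - O z c b := by unfold O; ring
      rw [i1]; rw [i2] at hp
      nlinarith
    by_contra hh; push Not at hh
    nlinarith [mul_nonneg hp'.le hh, mul_nonneg p1.le b1, mul_pos p2 c1]
end KW

namespace KW

structure Pr (a α b β : Fin 3 → R2) : Prop where
  pp : ∀ i j, PP (a (i+1)) (a (i+2)) (α i) (b (j+1)) (b (j+2)) (β j)
  hA : O (a 0) (a 1) (a 2) ≠ 0
  hB : O (b 0) (b 1) (b 2) ≠ 0

lemma Pr.symm {a α b β : Fin 3 → R2} (h : Pr a α b β) : Pr b β a α :=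
  ⟨fun i j => (h.pp j i).symm, h.hB, h.hA⟩

/-- edge functional and area -/
def L (a : Fin 3 → R2) (i : Fin 3) (x : R2) : ℝ := O (a (i+1)) (a (i+2)) x
def Dl (a : Fin 3 → R2) : ℝ := O (a 0) (a 1) (a 2)

lemma f3a (j : Fin 3) : j+2+1 = j := by revert j; decide
lemma Pr.gA {a α b β : Fin 3 → R2} (h : Pr a α b β) (i j : Fin 3) : L a i (b j) ≠ 0 := by
  have := (h.pp i (j+2)).g1
  rwa [f3a] at this
lemma Pr.gw {a α b β : Fin 3 → R2} (h : Pr a α b β) (i : Fin 3) : L a i (α i) ≠ 0 := by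
  have := (h.pp i 0).h1.hO
  rwa [← O_rot] at this

lemma Lsum (a : Fin 3 → R2) (x : R2) : L a 0 x + L a 1 x + L a 2 x = Dl a := by
  simp [L, Dl, O]; ring
lemma L_self (a : Fin 3 → R2) (i : Fin 3) : L a i (a i) = Dl a := by
  fin_cases i <;> simp [L, Dl, O] <;> ring
lemma L_off (a : Fin 3 → R2) (i k : Fin 3) (h : k ≠ i) : L a i (a k) = 0 := by
  fin_cases i <;> fin_cases k <;> simp [L, O] at h ⊢ <;> ring
lemma L_nn (a : Fin 3 → R2) (i k : Fin 3) : 0 ≤ L a i (a k) * Dl a := by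
  by_cases h : k = i
  · subst h; rw [L_self]; exact mul_self_nonneg _
  · rw [L_off _ _ _ h]; simp

noncomputable def sg (a : Fin 3 → R2) (i : Fin 3) (x : R2) : Bool := decide (0 < L a i x * Dl a)

lemma sg_t {a : Fin 3 → R2} {i : Fin 3} {x : R2} : sg a i x = true ↔ 0 < L a i x * Dl a := by simp [sg]
lemma sg_f {a : Fin 3 → R2} {i : Fin 3} {x : R2} (h : L a i x ≠ 0) (h' : Dl a ≠ 0) : 
    sg a i x = false ↔ L a i x * Dl a < 0 := by
  have := mul_ne_zero h h'
  simp only [sg, decide_eq_false_iff_not, not_lt]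
  exact ⟨fun k => lt_of_le_of_ne k this, le_of_lt⟩
lemma sgn_aux {x y d : ℝ} (hx : x ≠ 0) (hy : y ≠ 0) (hd : d ≠ 0) : 
    ((0 < x * d) ↔ (0 < y * d)) ↔ 0 < x * y := by
  rcases lt_or_gt_of_ne hx with h1 | h1 <;> rcases lt_or_gt_of_ne hy with h2 | h2 <;> rcases lt_or_gt_of_ne hd with h3 | h3 <;>
   simp [mul_pos_iff, h1, h2, h3, not_lt_of_gt]
lemma sg_eq {a : Fin 3 → R2} {i : Fin 3} {x y : R2} (h : L a i x ≠ 0) (h2 : L a i y ≠ 0) (h' : Dl a ≠ 0) : 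
    sg a i x = sg a i y ↔ 0 < L a i x * L a i y := by
  rw [← sgn_aux h h2 h']; simp [sg]
lemma sg_ne {a : Fin 3 → R2} {i : Fin 3} {x y : R2} (h : L a i x ≠ 0) (h2 : L a i y ≠ 0) (h' : Dl a ≠ 0) : 
    sg a i x ≠ sg a i y ↔ L a i x * L a i y < 0 := by
  rw [Ne, sg_eq h h2 h', not_lt]
  have := mul_ne_zero h h2
  exact ⟨fun k => lt_of_le_of_ne k this, le_of_lt⟩

lemma Pr.N2 {a α b β : Fin 3 → R2} (h : Pr a α b β) (i j k : Fin 3) (hjk : j ≠ k) : ¬ (sg a i (b j) = sg a i (α i) ∧ sg a i (b k) = sg a i (α i)) := by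
  rintro ⟨h1, h2⟩
  have h3 : sg a i (b j) = sg a i (b k) := by rw [h1, h2]
  rw [sg_eq (h.gA _ _) (h.gw _) h.hA] at h1 h2
  rw [sg_eq (h.gA _ _) (h.gA _ _) h.hA] at h3
  have key : ∀ m, 0 < L a i (b (m+1)) * L a i (b (m+2)) → 0 < L a i (b (m+1)) * L a i (α i) → False := by
    intro m hm hm'
    have := KW.N2 (h.pp i m) hm
    unfold L at *; linarith
  have h3' : 0 < L a i (b k) * L a i (b j) := by linarith
  revert h1 h2 h3 h3' hjk
  fin_cases j <;> fin_cases k <;> intro h0 h1 h2 h3 h4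
  all_goals first | exact absurd rfl h0 | exact key 2 h3 h1 | exact key 2 h4 h2 | exact key 0 h3 h1 | exact key 0 h4 h2 | exact key 1 h3 h1 | exact key 1 h4 h2
lemma Pr.cr {a α b β : Fin 3 → R2} (h : Pr a α b β) (i j : Fin 3) : sg a i (b (j+1)) ≠ sg a i (b (j+2)) ↔ sg b j (a (i+1)) ≠ sg b j (a (i+2)) := by
  rw [sg_ne (h.gA _ _) (h.gA _ _) h.hA, sg_ne (h.symm.gA _ _) (h.symm.gA _ _) h.hB]
  exact sep_iff (h.pp i j)
lemma Pr.G1 {a α b β : Fin 3 → R2} (h : Pr a α b β) (j : Fin 3) : ∃ i, sg a i (b j) = true := by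
  by_contra hh
  push Not at hh
  have k := fun i => (sg_f (h.gA i j) h.hA).1 (by simpa using hh i)
  have s := Lsum a (b j)
  have t : 0 ≤ Dl a * Dl a := mul_self_nonneg _
  have e : Dl a * Dl a = L a 0 (b j) * Dl a + L a 1 (b j) * Dl a + L a 2 (b j) * Dl a := by
    rw [← add_mul, ← add_mul, s]
  linarith [k 0, k 1, k 2]
/-- orientation of a crossing -/
lemma Pr.cro {a α b β : Fin 3 → R2} (h : Pr a α b β) (i j : Fin 3) (hx : sg a i (b (j+1)) ≠ sg a i (b (j+2))) : 
   (0 < L a i (b (j+1)) ∧ L a i (b (j+2)) < 0 ∧ 0 < L b j (a (i+2)) ∧ L b j (a (i+1)) < 0) ∨ 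
   (L a i (b (j+1)) < 0 ∧ 0 < L a i (b (j+2)) ∧ L b j (a (i+2)) < 0 ∧ 0 < L b j (a (i+1))) := by
  have hy := (h.cr i j).1 hx
  rw [sg_ne (h.gA _ _) (h.gA _ _) h.hA] at hx
  rw [sg_ne (h.symm.gA _ _) (h.symm.gA _ _) h.hB] at hy
  have e : L b j (a (i+2)) - L b j (a (i+1)) = L a i (b (j+1)) - L a i (b (j+2)) := by unfold L O; ring
  rcases lt_or_gt_of_ne (h.gA i (j+1)) with k1 | k1 <;> rcases lt_or_gt_of_ne (h.symm.gA j (i+1)) with k2 | k2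
  · exfalso; nlinarith [pos_of_mul_neg_right hx k1.le, pos_of_mul_neg_right hy k2.le]
  · right; exact ⟨k1, pos_of_mul_neg_right hx k1.le, by nlinarith, k2⟩
  · left; exact ⟨k1, by nlinarith, by nlinarith, k2⟩
  · exfalso; 
    have : L a i (b (j+2)) < 0 := by nlinarith
    have : L b j (a (i+2)) < 0 := by nlinarith
    linarith
lemma Pr.G2 {a α b β : Fin 3 → R2} (h : Pr a α b β) (i j k : Fin 3) (hx : sg a i (b (j+1)) ≠ sg a i (b (j+2))) : 
    sg a k (b (j+1)) = true ∨ sg a k (b (j+2)) = true := by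
  by_contra hh; push Not at hh
  obtain ⟨h1, h2⟩ := hh
  have h1 := (sg_f (h.gA k (j+1)) h.hA).1 (by simpa using h1)
  have h2 := (sg_f (h.gA k (j+2)) h.hA).1 (by simpa using h2)
  have e := crossId (a (i+1)) (a (i+2)) (b (j+1)) (b (j+2)) (a (k+1)) (a (k+2))
  have e : L b j (a (i+2)) * (L a k (a (i+1)) * Dl a) - L b j (a (i+1)) * (L a k (a (i+2)) * Dl a) = 
    L a i (b (j+1)) * (L a k (b (j+2)) * Dl a) - L a i (b (j+2)) * (L a k (b (j+1)) * Dl a) := by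
    unfold L; linear_combination (Dl a) * e
  have n1 := L_nn a k (i+1)
  have n2 := L_nn a k (i+2)
  rcases h.cro i j hx with ⟨c1, c2, c3, c4⟩ | ⟨c1, c2, c3, c4⟩
  · nlinarith [mul_nonneg c3.le n1, mul_nonneg (neg_pos.2 c4).le n2, mul_pos c1 (neg_pos.2 h2), mul_pos (neg_pos.2 c2) (neg_pos.2 h1)]
  · nlinarith [mul_nonneg c4.le n2, mul_nonneg (neg_pos.2 c3).le n1, mul_pos c2 (neg_pos.2 h1), mul_pos (neg_pos.2 c1) (neg_pos.2 h2)]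
lemma Pr.G3 {a α b β : Fin 3 → R2} (h : Pr a α b β) (i j : Fin 3) (hx : sg a i (b (j+1)) ≠ sg a i (b (j+2))) (hy : sg a (i+1) (b (j+1)) ≠ sg a (i+1) (b (j+2))) : 
   sg a i (b (j+1)) ≠ sg a (i+1) (b (j+1)) := by
  have e : i + 1 + 1 = i + 2 := by clear hx hy; revert i; decide
  have c2 := h.cro (i+1) j hy
  rw [e] at c2
  have d := h.hA
  change Dl a ≠ 0 at d
  intro hh
  have hh := Bool.eq_iff_iff.1 hh
  rw [sg_t, sg_t] at hh
  have g := sgn_aux (h.gA i (j+1)) (h.gA (i+1) (j+1)) d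
  have g := g.1 hh
  rcases h.cro i j hx with c1 | c1 <;> rcases c2 with c2 | c2 <;> nlinarith

lemma comb : ∀ f0 f1 f2 g0 g1 g2 : Fin 4, 
   (∀ i j : Fin 3, (![f0,f1,f2] i ≠ 3 ∧ ![f0,f1,f2] i ≠ j.castSucc) ↔ (![g0,g1,g2] j ≠ 3 ∧ ![g0,g1,g2] j ≠ i.castSucc)) → 
   (∀ i, ![f0,f1,f2] i = 3 ∧ ![g0,g1,g2] i = 3) ∨ 
   (∃ i0 j0 : Fin 3, (∀ i, ![f0,f1,f2] i = if i = i0 then 3 else j0.castSucc) ∧ (∀ j, ![g0,g1,g2] j = if j = j0 then 3 else i0.castSucc)) ∨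
   ((∀ i, ![f0,f1,f2] i ≠ 3) ∧ (∀ i, ![g0,g1,g2] i ≠ 3) ∧ (∀ i j : Fin 3, ![f0,f1,f2] i = j.castSucc ↔ ![g0,g1,g2] j = i.castSucc)) := by
  decide +kernel

lemma row (r : Fin 3 → Bool) (u : Bool) (h : ∀ j k, j ≠ k → ¬ (r j = u ∧ r k = u)) :
    ∃ f : Fin 4, ∀ j : Fin 3, r j = u ↔ f = j.castSucc := by
  by_cases hh : ∃ j, r j = u
  · obtain ⟨j, hj⟩ := hh
    refine ⟨j.castSucc, fun k => ⟨fun hk => ?_, fun hk => ?_⟩⟩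
    · by_contra hne
      exact h j k (fun e => hne (by rw [e])) ⟨hj, hk⟩
    · rw [← Fin.castSucc_injective _ hk]; exact hj
  · push Not at hh
    refine ⟨3, fun j => ⟨fun k => absurd k (hh j), fun k => ?_⟩⟩
    exfalso; revert k; revert j; decide

lemma rowx (r : Fin 3 → Bool) (u : Bool) (f : Fin 4) (h : ∀ j : Fin 3, r j = u ↔ f = j.castSucc) (j : Fin 3) :
    r (j+1) ≠ r (j+2) ↔ f ≠ 3 ∧ f ≠ j.castSucc := by
  have h1 := h (j+1)
  have h2 := h (j+2)
  generalize r (j+1) = x at *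
  generalize r (j+2) = y at *
  clear h
  revert x y u f j
  decide

def T0 (S : Fin 3 → Fin 3 → Bool) (u : Fin 3 → Bool) : Prop := ∀ i j, S i j = !u i
def T4 (S : Fin 3 → Fin 3 → Bool) (u : Fin 3 → Bool) (i0 j0 : Fin 3) : Prop :=
  ∀ i j, S i j = if i ≠ i0 ∧ j = j0 then u i else !u i
def T6 (S : Fin 3 → Fin 3 → Bool) (u : Fin 3 → Bool) (σ : Fin 3 → Fin 3) : Prop :=
  ∀ i j, S i j = if j = σ i then u i else !u i

lemma Bne {x u : Bool} : x ≠ u ↔ x = !u := by revert x u; decide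

lemma cls (S U : Fin 3 → Fin 3 → Bool) (u v : Fin 3 → Bool)
   (h1 : ∀ i j k, j ≠ k → ¬ (S i j = u i ∧ S i k = u i))
   (h2 : ∀ i j k, j ≠ k → ¬ (U i j = v i ∧ U i k = v i))
   (hx : ∀ i j, S i (j+1) ≠ S i (j+2) ↔ U j (i+1) ≠ U j (i+2)) :
   (T0 S u ∧ T0 U v) ∨ (∃ i0 j0, T4 S u i0 j0 ∧ T4 U v j0 i0) ∨
   (∃ σ τ : Fin 3 → Fin 3, T6 S u σ ∧ T6 U v τ ∧ ∀ i j, σ i = j ↔ τ j = i) := by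
  choose f hf using fun i => row (S i) (u i) (h1 i)
  choose g hg using fun i => row (U i) (v i) (h2 i)
  have hfe : ![f 0, f 1, f 2] = f := by ext i; fin_cases i <;> rfl
  have hge : ![g 0, g 1, g 2] = g := by ext i; fin_cases i <;> rfl
  have c := comb (f 0) (f 1) (f 2) (g 0) (g 1) (g 2)
  rw [hfe, hge] at c
  have c := c (fun i j => by rw [← rowx _ _ _ (hf i), ← rowx _ _ _ (hg j)]; exact hx i j)
  have n3 : ∀ j : Fin 3, (3 : Fin 4) ≠ j.castSucc := by decide
  have ex : ∀ k : Fin 4, k ≠ 3 → ∃ j : Fin 3, k = j.castSucc := by decide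
  rcases c with c | ⟨i0, j0, c1, c2⟩ | ⟨c1, c2, c3⟩
  · left
    constructor
    · intro i j; rw [← Bne, Ne, hf, (c i).1]; exact n3 j
    · intro i j; rw [← Bne, Ne, hg, (c i).2]; exact n3 j
  · right; left
    refine ⟨i0, j0, ?_, ?_⟩
    · intro i j
      split_ifs with hc
      · rw [hf, c1, if_neg hc.1, hc.2]
      · rw [← Bne, Ne, hf, c1]
        split_ifs with hd
        · exact n3 j
        · intro e; exact hc ⟨hd, (Fin.castSucc_injective _ e).symm⟩
    · intro i j
      split_ifs with hc
      · rw [hg, c2, if_neg hc.1, hc.2]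
      · rw [← Bne, Ne, hg, c2]
        split_ifs with hd
        · exact n3 j
        · intro e; exact hc ⟨hd, (Fin.castSucc_injective _ e).symm⟩
  · right; right
    choose σ hσ using fun i => ex _ (c1 i)
    choose τ hτ using fun i => ex _ (c2 i)
    refine ⟨σ, τ, ?_, ?_, ?_⟩
    · intro i j
      split_ifs with hc
      · rw [hf, hσ, hc]
      · rw [← Bne, Ne, hf, hσ]
        intro e; exact hc (Fin.castSucc_injective _ e).symm
    · intro i j
      split_ifs with hc
      · rw [hg, hτ, hc]
      · rw [← Bne, Ne, hg, hτ]
        intro e; exact hc (Fin.castSucc_injective _ e).symm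
    · intro i j
      have := c3 i j
      rw [hσ, hτ] at this
      rwa [Fin.castSucc_inj, Fin.castSucc_inj] at this

noncomputable abbrev SS (a b : Fin 3 → R2) : Fin 3 → Fin 3 → Bool := fun i j => sg a i (b j)
noncomputable abbrev uu (a α : Fin 3 → R2) : Fin 3 → Bool := fun i => sg a i (α i)

def P0 (a α b β : Fin 3 → R2) : Prop := T0 (SS a b) (uu a α) ∧ T0 (SS b a) (uu b β)
def P4 (a α b β : Fin 3 → R2) (i0 j0 : Fin 3) : Prop := T4 (SS a b) (uu a α) i0 j0 ∧ T4 (SS b a) (uu b β) j0 i0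
def P6 (a α b β : Fin 3 → R2) (σ τ : Fin 3 → Fin 3) : Prop :=
  T6 (SS a b) (uu a α) σ ∧ T6 (SS b a) (uu b β) τ ∧ ∀ i j, σ i = j ↔ τ j = i

lemma P0.symm {a α b β : Fin 3 → R2} (h : P0 a α b β) : P0 b β a α := ⟨h.2, h.1⟩
lemma P4.symm {a α b β : Fin 3 → R2} {i j : Fin 3} (h : P4 a α b β i j) : P4 b β a α j i := ⟨h.2, h.1⟩
lemma P6.symm {a α b β : Fin 3 → R2} {i j : Fin 3 → Fin 3} (h : P6 a α b β i j) : P6 b β a α j i :=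
  ⟨h.2.1, h.1, fun x y => (h.2.2 y x).symm⟩

lemma Pr.cls {a α b β : Fin 3 → R2} (h : Pr a α b β) :
   P0 a α b β ∨ (∃ i0 j0, P4 a α b β i0 j0) ∨ (∃ σ τ, P6 a α b β σ τ) :=
  KW.cls _ _ _ _ h.N2 h.symm.N2 h.cr

lemma Pr.o0 {a α b β : Fin 3 → R2} (h : Pr a α b β) (h0 : P0 a α b β) : ∃ i, uu a α i = false := by
  obtain ⟨i, hi⟩ := h.G1 0
  have := h0.1 i 0
  refine ⟨i, ?_⟩
  simp only [SS] at this
  rw [hi] at this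
  simpa using this.symm
lemma Pr.o4 {a α b β : Fin 3 → R2} (h : Pr a α b β) {i0 j0 : Fin 3} (h4 : P4 a α b β i0 j0) :
   uu a α i0 = false ∧ uu a α (i0+1) ≠ uu a α (i0+2) := by
  have g2 := h.G2 (i0+1) (j0+1) i0
  have g3 := h.G3 (i0+1) (j0+1)
  have k := h4.1
  simp only [T4, SS] at k
  simp only [k] at g2 g3
  generalize uu a α = u at *
  have e : i0 + 1 + 1 = i0 + 2 := by clear * -; revert i0; decide
  rw [e] at g3
  generalize u i0 = x at *
  generalize u (i0+1) = y at *
  generalize u (i0+2) = z at *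
  clear * - g2 g3
  revert g2 g3
  revert x y z
  fin_cases i0 <;> fin_cases j0 <;> decide
lemma Pr.o6 {a α b β : Fin 3 → R2} (h : Pr a α b β) {σ τ : Fin 3 → Fin 3} (h6 : P6 a α b β σ τ) (k : Fin 3) :
   uu a α k = false := by
  have g2 := h.G2 (k+1) (σ k) k
  have t := h6.1
  simp only [T6, SS] at t
  simp only [t] at g2
  have hne : σ k ≠ σ (k+1) := by
    intro e
    have h1 := (h6.2.2 k (σ k)).1 rfl
    have h2 := (h6.2.2 (k+1) (σ k)).1 e.symm
    rw [h1] at h2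
    clear * - h2
    revert k; decide
  generalize σ k = x at *
  generalize σ (k+1) = y at *
  generalize uu a α (k+1) = z at *
  generalize uu a α k = z' at *
  clear * - hne g2
  revert x y z z'
  decide

lemma mixed {a α c γ : Fin 3 → R2} (h : Pr a α c γ) (h0 : P0 a α c γ) (ho : ∀ i, uu a α i = false) : False := by
  have p : ∀ i, 0 < L a i (c 1) * Dl a := by
    intro i
    have := h0.1 i 1
    rw [ho i] at this
    exact sg_t.1 this
  have q : ∀ i k, 0 < L c 0 (a i) * L c 0 (a k) := by
    intro i k
    rw [← sg_eq (h.symm.gA _ _) (h.symm.gA _ _) h.hB]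
    have h1 := h0.2 0 i
    have h2 := h0.2 0 k
    simp only [SS] at h1 h2
    rw [h1, h2]
  have e : L a 0 (c 1) * L c 0 (a 0) + L a 1 (c 1) * L c 0 (a 1) + L a 2 (c 1) * L c 0 (a 2) = 0 := by
    simp [L, O]; ring
  have e : (L a 0 (c 1) * Dl a) * (L c 0 (a 0) * L c 0 (a 0)) + (L a 1 (c 1) * Dl a) * (L c 0 (a 1) * L c 0 (a 0))
     + (L a 2 (c 1) * Dl a) * (L c 0 (a 2) * L c 0 (a 0)) = 0 := by
    linear_combination (Dl a * L c 0 (a 0)) * e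
  nlinarith [mul_pos (p 0) (q 0 0), mul_pos (p 1) (q 1 0), mul_pos (p 2) (q 2 0)]

lemma LL0 {A1 A2 A3 D1 D2 D3 B : R2} (sA : 0 < O A1 A2 A3)
   (d1 : 0 < O A2 A3 D1 * O A1 A2 A3) (d2 : 0 < O A3 A1 D1 * O A1 A2 A3) (d3 : O A1 A2 D1 * O A1 A2 A3 < 0)
   (b1 : O A2 A3 B * O A1 A2 A3 < 0) (b2 : 0 < O A3 A1 B * O A1 A2 A3) (b3 : 0 < O A1 A2 B * O A1 A2 A3)
   (a2 : 0 < O D3 D1 A1 * O D1 D2 D3) (a3 : O D1 D2 A1 * O D1 D2 D3 < 0)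
   (a5 : O D3 D1 A3 * O D1 D2 D3 < 0)
   (b5 : 0 < O D3 D1 B * O D1 D2 D3) (b6 : 0 < O D1 D2 B * O D1 D2 D3) : False := by
  have d1 := pos_of_mul_pos_left d1 sA.le
  have d2 := pos_of_mul_pos_left d2 sA.le
  have d3 := neg_of_mul_neg_left d3 sA.le
  have b1 := neg_of_mul_neg_left b1 sA.le
  have b2 := pos_of_mul_pos_left b2 sA.le
  have b3 := pos_of_mul_pos_left b3 sA.le
  have e1 : O A1 A2 A3 * O A1 D1 B = O A3 A1 D1 * O A1 A2 B - O A1 A2 D1 * O A3 A1 B := by unfold O; ring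
  have x1 : 0 < O A1 D1 B := by
    refine pos_of_mul_pos_right (a := O A1 A2 A3) ?_ sA.le
    rw [e1]; nlinarith [mul_pos d2 b3, mul_pos (neg_pos.2 d3) b2]
  have e2 : O D1 D2 D3 * O D1 A1 B = O D3 D1 A1 * O D1 D2 B - O D1 D2 A1 * O D3 D1 B := by unfold O; ring
  have sD : O D1 D2 D3 < 0 := by
    by_contra hh; push Not at hh
    have hh : 0 < O D1 D2 D3 := lt_of_le_of_ne hh (by intro e; rw [← e] at a2; simp at a2)
    have a2 := pos_of_mul_pos_left a2 hh.le
    have a3 := neg_of_mul_neg_left a3 hh.le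
    have b5 := pos_of_mul_pos_left b5 hh.le
    have b6 := pos_of_mul_pos_left b6 hh.le
    rw [O_sw' A1 D1 B] at e2
    nlinarith [mul_pos a2 b6, mul_pos (neg_pos.2 a3) b5, mul_pos hh x1]
  have e3 : O A1 A2 A3 * O A3 D1 B = O A2 A3 D1 * O A3 A1 B - O A3 A1 D1 * O A2 A3 B := by unfold O; ring
  have x2 : 0 < O A3 D1 B := by
    refine pos_of_mul_pos_right (a := O A1 A2 A3) ?_ sA.le
    rw [e3]; nlinarith [mul_pos d1 b2, mul_pos d2 (neg_pos.2 b1)]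
  have y1 : O D3 D1 A1 < 0 := by nlinarith
  have y2 : O D3 D1 B < 0 := by nlinarith
  have y3 : 0 < O D3 D1 A3 := by nlinarith
  have e := bary A1 D1 A3 B D3 D1
  simp only [O_bb] at e
  have i1 : O A1 D1 A3 = O A3 A1 D1 := by unfold O; ring
  have i2 : O B D1 A3 = - O A3 D1 B := by unfold O; ring
  rw [i1, i2] at e
  nlinarith [mul_pos d2 (neg_pos.2 y2), mul_pos x2 (neg_pos.2 y1), mul_pos x1 y3]
lemma LL {A1 A2 A3 D1 D2 D3 B : R2}
   (d1 : 0 < O A2 A3 D1 * O A1 A2 A3) (d2 : 0 < O A3 A1 D1 * O A1 A2 A3) (d3 : O A1 A2 D1 * O A1 A2 A3 < 0)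
   (b1 : O A2 A3 B * O A1 A2 A3 < 0) (b2 : 0 < O A3 A1 B * O A1 A2 A3) (b3 : 0 < O A1 A2 B * O A1 A2 A3)
   (a2 : 0 < O D3 D1 A1 * O D1 D2 D3) (a3 : O D1 D2 A1 * O D1 D2 D3 < 0)
   (a5 : O D3 D1 A3 * O D1 D2 D3 < 0)
   (b5 : 0 < O D3 D1 B * O D1 D2 D3) (b6 : 0 < O D1 D2 B * O D1 D2 D3) : False := by
  rcases lt_or_ge 0 (O A1 A2 A3) with k | k
  · exact LL0 k d1 d2 d3 b1 b2 b3 a2 a3 a5 b5 b6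
  · have k : O A1 A2 A3 < 0 := lt_of_le_of_ne k (by intro e; rw [e] at d1; simp at d1)
    refine LL0 (A1 := rf A1) (A2 := rf A2) (A3 := rf A3) (D1 := rf D1) (D2 := rf D2) (D3 := rf D3) (B := rf B)
      ?_ ?_ ?_ ?_ ?_ ?_ ?_ ?_ ?_ ?_ ?_ ?_ <;> simp only [O_rf, neg_mul_neg] <;> first | assumption | linarith

lemma sgp (a : Fin 3 → R2) (i j k : Fin 3) (h1 : i ≠ j) (h2 : j ≠ k) (h3 : i ≠ k) (x : R2) :
   L a i x * Dl a = O (a j) (a k) x * O (a i) (a j) (a k) := by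
  fin_cases i <;> fin_cases j <;> fin_cases k <;> first | exact absurd rfl h1 | exact absurd rfl h2 | exact absurd rfl h3 | (simp [L, Dl, O]; first | done | ring1 | (left; ring1))
end KW

namespace KW

def NC (a b : Fin 3 → R2) (i j : Fin 3) : Prop := 0 < L a i (b (j+1)) * L a i (b (j+2))
lemma Pr.ncs {a α b β : Fin 3 → R2} (h : Pr a α b β) {i j : Fin 3} (k : NC a b i j) : NC b a j i :=
  nsep (h.pp i j) k
lemma Pr.nc0 {a α b β : Fin 3 → R2} (h : Pr a α b β) (h0 : P0 a α b β) (i j : Fin 3) : NC a b i j := by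
  unfold NC
  rw [← sg_eq (h.gA _ _) (h.gA _ _) h.hA]
  have h1 := h0.1 i (j+1)
  have h2 := h0.1 i (j+2)
  simp only [SS] at h1 h2
  rw [h1, h2]
lemma Pr.nc4 {a α b β : Fin 3 → R2} (h : Pr a α b β) {i0 j0 : Fin 3} (h0 : P4 a α b β i0 j0) (j : Fin 3) : NC a b i0 j := by
  unfold NC
  rw [← sg_eq (h.gA _ _) (h.gA _ _) h.hA]
  have h1 := h0.1 i0 (j+1)
  have h2 := h0.1 i0 (j+2)
  simp only [SS] at h1 h2
  rw [h1, h2]; simp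
lemma Pr.nc4' {a α b β : Fin 3 → R2} (h : Pr a α b β) {i0 j0 : Fin 3} (h0 : P4 a α b β i0 j0) (i : Fin 3) : NC a b i j0 :=
  h.symm.ncs (h.symm.nc4 h0.symm i)

lemma ac3 {a α b β c γ : Fin 3 → R2} (h : Pr a α b β) (h' : Pr a α c γ) {i j k : Fin 3} (n : NC a b i j) (n' : NC a c i k) :
   0 < dt (α i) (β j) (γ k) :=
  cone_acute (h.pp i j).h1.hO (h.pp i j).h1.hpq (N1 (h.pp i j) n) (N1' (h.pp i j) n) (N1 (h'.pp i k) n') (N1' (h'.pp i k) n')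

def Cfg (v w : Fin 4 → Fin 3 → R2) : Prop := ∀ X Y, X ≠ Y → Pr (v X) (w X) (v Y) (w Y)

lemma trv {v w : Fin 4 → Fin 3 → R2} (h : Cfg v w) {A B C D : Fin 4} (hAB : A ≠ B) (hAC : A ≠ C) (hAD : A ≠ D)
   (hBC : B ≠ C) (hBD : B ≠ D) (hCD : C ≠ D) {a b c d : Fin 3} (n1 : NC (v A) (v B) a b) (n2 : NC (v A) (v C) a c)
   (n3 : NC (v A) (v D) a d) (n4 : NC (v B) (v C) b c) (n5 : NC (v B) (v D) b d) (n6 : NC (v C) (v D) c d) : False := by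
  have m1 := (h _ _ hAB).ncs n1
  have m2 := (h _ _ hAC).ncs n2
  have m3 := (h _ _ hAD).ncs n3
  have m4 := (h _ _ hBC).ncs n4
  have m5 := (h _ _ hBD).ncs n5
  have m6 := (h _ _ hCD).ncs n6
  exact four_acute (w A a) (w B b) (w C c) (w D d)
    (ac3 (h _ _ hAB) (h _ _ hAC) n1 n2) (ac3 (h _ _ hAC) (h _ _ hAD) n2 n3) (ac3 (h _ _ hAB) (h _ _ hAD) n1 n3)
    (ac3 (h _ _ hAB.symm) (h _ _ hBC) m1 n4) (ac3 (h _ _ hBC) (h _ _ hBD) n4 n5) (ac3 (h _ _ hAB.symm) (h _ _ hBD) m1 n5)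
    (ac3 (h _ _ hAC.symm) (h _ _ hBC.symm) m2 m4) (ac3 (h _ _ hBC.symm) (h _ _ hCD) m4 n6) (ac3 (h _ _ hAC.symm) (h _ _ hCD) m2 n6)
    (ac3 (h _ _ hAD.symm) (h _ _ hBD.symm) m3 m5) (ac3 (h _ _ hBD.symm) (h _ _ hCD.symm) m5 m6) (ac3 (h _ _ hAD.symm) (h _ _ hCD.symm) m3 m6)

lemma Llem {a α d δ b β : Fin 3 → R2} (h1 : Pr a α d δ) (h2 : Pr a α b β) (h3 : Pr d δ b β) {a1 a3 d1 d3 b3 : Fin 3}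
   (p1 : P4 a α d δ a1 d1) (p2 : P4 a α b β a3 b3) (p3 : P4 d δ b β d3 b3) (na : a1 ≠ a3) (nd : d1 ≠ d3) : False := by
  obtain ⟨a2, na1, na3⟩ : ∃ a2 : Fin 3, a2 ≠ a1 ∧ a2 ≠ a3 := by
    clear * -; revert a1 a3; decide
  obtain ⟨d2, nd1, nd3⟩ : ∃ a2 : Fin 3, a2 ≠ d1 ∧ a2 ≠ d3 := by
    clear * -; revert d1 d3; decide
  have o1 := (h1.o4 p1).1
  have o3 := (h2.o4 p2).1
  have o2 : uu a α a2 = true := by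
    have o := (h1.o4 p1).2
    have ee := o
    have : (a1 + 1 = a2 ∧ a1 + 2 = a3) ∨ (a1 + 1 = a3 ∧ a1 + 2 = a2) := by
      clear * - na na1 na3; revert a1 a2 a3; decide
    rcases this with ⟨x, y⟩ | ⟨x, y⟩ <;> rw [x, y, o3] at o <;> simpa using o
  have q1 := (h1.symm.o4 p1.symm).1
  have q3 := (h3.o4 p3).1
  have q2 : uu d δ d2 = true := by
    have o := (h1.symm.o4 p1.symm).2
    have : (d1 + 1 = d2 ∧ d1 + 2 = d3) ∨ (d1 + 1 = d3 ∧ d1 + 2 = d2) := by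
      clear * - nd nd1 nd3; revert d1 d2 d3; decide
    rcases this with ⟨x, y⟩ | ⟨x, y⟩ <;> rw [x, y, q3] at o <;> simpa using o
  have ps : ∀ {a α b β : Fin 3 → R2} (h : Pr a α b β) {i0 j0 : Fin 3} (p : P4 a α b β i0 j0) (i j k l m : Fin 3), 
      i ≠ k → k ≠ l → i ≠ l → (if i ≠ i0 ∧ j = j0 then uu a α i else !uu a α i) = true → 0 < O (a k) (a l) (b j) * O (a i) (a k) (a l) := by
    intro a α b β h i0 j0 p i j k l m n1 n2 n3 hh
    rw [← sgp a i k l n1 n2 n3, ← sg_t]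
    rw [← p.1 i j] at hh; exact hh
  have ns : ∀ {a α b β : Fin 3 → R2} (h : Pr a α b β) {i0 j0 : Fin 3} (p : P4 a α b β i0 j0) (i j k l m : Fin 3), 
      i ≠ k → k ≠ l → i ≠ l → (if i ≠ i0 ∧ j = j0 then uu a α i else !uu a α i) = false → O (a k) (a l) (b j) * O (a i) (a k) (a l) < 0 := by
    intro a α b β h i0 j0 p i j k l m n1 n2 n3 hh
    rw [← sgp a i k l n1 n2 n3, ← sg_f (h.gA _ _) h.hA]
    rw [← p.1 i j] at hh; exact hh
  have r (a : Fin 3 → R2) (i j k : Fin 3) : O (a j) (a k) (a i) = O (a i) (a j) (a k) := O_rot _ _ _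
  have r2 (a : Fin 3 → R2) (i j k : Fin 3) : O (a k) (a i) (a j) = O (a i) (a j) (a k) := O_rot2 _ _ _
  refine LL (A1 := a a1) (A2 := a a2) (A3 := a a3) (D1 := d d1) (D2 := d d2) (D3 := d d3) (B := b b3)
    ?_ ?_ ?_ ?_ ?_ ?_ ?_ ?_ ?_ ?_ ?_
  · exact ps h1 p1 a1 d1 a2 a3 0 na1.symm na3 na (by simp [o1])
  · rw [← r a a1 a2 a3]; exact ps h1 p1 a2 d1 a3 a1 0 na3 na.symm na1 (by simp [o2, na1])
  · rw [← r2 a a1 a2 a3]; exact ns h1 p1 a3 d1 a1 a2 0 na.symm na1.symm na3.symm (by simp [o3, na.symm])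
  · exact ns h2 p2 a1 b3 a2 a3 0 na1.symm na3 na (by simp [o1, na])
  · rw [← r a a1 a2 a3]; exact ps h2 p2 a2 b3 a3 a1 0 na3 na.symm na1 (by simp [o2, na3])
  · rw [← r2 a a1 a2 a3]; exact ps h2 p2 a3 b3 a1 a2 0 na.symm na1.symm na3.symm (by simp [o3])
  · rw [← r d d1 d2 d3]; exact ps h1.symm p1.symm d2 a1 d3 d1 0 nd3 nd.symm nd1 (by simp [q2, nd1])
  · rw [← r2 d d1 d2 d3]; exact ns h1.symm p1.symm d3 a1 d1 d2 0 nd.symm nd1.symm nd3.symm (by simp [q3, nd.symm])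
  · rw [← r d d1 d2 d3]; exact ns h1.symm p1.symm d2 a3 d3 d1 0 nd3 nd.symm nd1 (by simp [q2, nd1, na.symm])
  · rw [← r d d1 d2 d3]; exact ps h3 p3 d2 b3 d3 d1 0 nd3 nd.symm nd1 (by simp [q2, nd3])
  · rw [← r2 d d1 d2 d3]; exact ps h3 p3 d3 b3 d1 d2 0 nd.symm nd1.symm nd3.symm (by simp [q3])

/-- pure combinatorics of tips -/
lemma tips (tip : Fin 4 → Fin 4 → Fin 3) (Z : Fin 4 → Fin 4 → Prop)
   (H1 : ∀ X B C D : Fin 4, X ≠ B → X ≠ C → X ≠ D → B ≠ C → B ≠ D → C ≠ D → 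
      tip X B = tip X C ∨ tip X B = tip X D ∨ tip X C = tip X D)
   (H2 : ∀ A D B : Fin 4, A ≠ D → A ≠ B → D ≠ B → ¬ Z A D → ¬ Z A B → ¬ Z D B → tip A D ≠ tip A B → tip D A ≠ tip D B → 
      tip B A = tip B D → False)
   (H3 : ∀ A B C D : Fin 4, A ≠ B → A ≠ C → A ≠ D → B ≠ C → B ≠ D → C ≠ D → ∀ a b c d : Fin 3,
      (Z A B ∨ a = tip A B ∨ b = tip B A) → (Z A C ∨ a = tip A C ∨ c = tip C A) → (Z A D ∨ a = tip A D ∨ d = tip D A) →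
      (Z B C ∨ b = tip B C ∨ c = tip C B) → (Z B D ∨ b = tip B D ∨ d = tip D B) → (Z C D ∨ c = tip C D ∨ d = tip D C) → False) :
   False := by
  -- (i)
  have E1 : ∀ A B C D : Fin 4, A ≠ B → A ≠ C → A ≠ D → B ≠ C → B ≠ D → C ≠ D → tip A B = tip A C → tip A B = tip A D → False := by
    intro A B C D n1 n2 n3 n4 n5 n6 e1 e2
    exact H3 A B C D n1 n2 n3 n4 n5 n6 (tip A B) (tip B C) (tip C D) (tip D B) (by tauto) (by tauto) (by tauto) (by tauto) (by tauto) (by tauto)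
  have E2 : ∀ A B C D : Fin 4, A ≠ B → A ≠ C → A ≠ D → B ≠ C → B ≠ D → C ≠ D → ¬ Z A B := by
    intro A B C D n1 n2 n3 n4 n5 n6 z
    rcases H1 C A B D n2.symm n4.symm n6 n1 n3 n5 with e | e | e
    · exact H3 A B C D n1 n2 n3 n4 n5 n6 (tip A D) (tip B D) (tip C A) (tip D C) (by tauto) (by tauto) (by tauto) (by tauto) (by tauto) (by tauto)
    · exact H3 A B C D n1 n2 n3 n4 n5 n6 (tip A D) (tip B C) (tip C A) (tip D B) (by tauto) (by tauto) (by tauto) (by tauto) (by tauto) (by tauto)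
    · exact H3 A B C D n1 n2 n3 n4 n5 n6 (tip A C) (tip B D) (tip C B) (tip D A) (by tauto) (by tauto) (by tauto) (by tauto) (by tauto) (by tauto)
  have E3 : ∀ A B C D : Fin 4, A ≠ B → A ≠ C → A ≠ D → B ≠ C → B ≠ D → C ≠ D → tip A B = tip A C → tip D A = tip D B → False := by
    intro A B C D n1 n2 n3 n4 n5 n6 e1 e2
    exact H3 A B C D n1 n2 n3 n4 n5 n6 (tip A B) (tip B C) (tip C D) (tip D A) (by tauto) (by tauto) (by tauto) (by tauto) (by tauto) (by tauto)
  -- (iii): if A's partner is D, then D's partner is A, etc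
  have E4 : ∀ A B C D : Fin 4, A ≠ B → A ≠ C → A ≠ D → B ≠ C → B ≠ D → C ≠ D → tip A B = tip A C → False := by
    intro A B C D n1 n2 n3 n4 n5 n6 e
    have d1 : tip D A ≠ tip D B := fun e2 => E3 A B C D n1 n2 n3 n4 n5 n6 e e2
    have d2 : tip D A ≠ tip D C := fun e2 => E3 A C B D n2 n1 n3 n4.symm n6 n5 e.symm e2
    have d3 : tip D B = tip D C := by
      rcases H1 D A B C n3.symm n5.symm n6.symm n1 n2 n4 with e | e | e <;> tauto
    have a1 : tip A D ≠ tip A B := fun e2 => E1 A B C D n1 n2 n3 n4 n5 n6 e e2.symm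
    rcases H1 B A C D n1.symm n4 n5 n2 n3 n6 with f | f | f
    · -- partner of B is D; 
      exact E3 B C A D n4 n1.symm n5 n2.symm n6 n3 f.symm d3
    · exact H2 A D B n3 n1 n5.symm (E2 A D B C n3 n1 n2 n5.symm n6.symm n4) (E2 A B C D n1 n2 n3 n4 n5 n6)
        (E2 D B A C n5.symm n3.symm n6.symm n1.symm n4 n2) a1 d1 f
    · exact E3 B C D A n4 n5 n1.symm n6 n2.symm n3.symm f e
  rcases H1 0 1 2 3 (by decide) (by decide) (by decide) (by decide) (by decide) (by decide) with e | e | e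
  · exact E4 0 1 2 3 (by decide) (by decide) (by decide) (by decide) (by decide) (by decide) e
  · exact E4 0 1 3 2 (by decide) (by decide) (by decide) (by decide) (by decide) (by decide) e
  · exact E4 0 2 3 1 (by decide) (by decide) (by decide) (by decide) (by decide) (by decide) e

lemma out2 (u : Fin 3 → Bool) (i0 x y z : Fin 3) (_h0 : u i0 = false) (h : u (i0+1) ≠ u (i0+2)) (hx : u x = false)
   (hy : u y = false) (hz : u z = false) : x = y ∨ x = z ∨ y = z := by
  by_contra hh
  push Not at hh
  obtain ⟨k1, k2, k3⟩ := hh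
  have : ∀ i : Fin 3, i = x ∨ i = y ∨ i = z := by
    clear * - k1 k2 k3; revert x y z; decide
  have all : ∀ i, u i = false := by
    intro i; rcases this i with e | e | e <;> rw [e] <;> assumption
  apply h; rw [all, all]

lemma no6 {v w : Fin 4 → Fin 3 → R2} (h : Cfg v w)
   (hc : ∀ X Y, X ≠ Y → P0 (v X) (w X) (v Y) (w Y) ∨ ∃ i j, P4 (v X) (w X) (v Y) (w Y) i j) : False := by
  have hdef : ∀ X, ∃ i, uu (v X) (w X) i = false := by
    intro X
    obtain ⟨Y, hY⟩ : ∃ Y : Fin 4, X ≠ Y := by clear * -; revert X; decide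
    rcases hc X Y hY with k | ⟨i, j, k⟩
    · exact (h X Y hY).o0 k
    · exact ⟨i, ((h X Y hY).o4 k).1⟩
  choose df hdf using hdef
  have hp : ∀ X Y, ∃ p : Fin 3 × Fin 3, X ≠ Y → (P0 (v X) (w X) (v Y) (w Y) ∧ p = (df X, df Y)) ∨ P4 (v X) (w X) (v Y) (w Y) p.1 p.2 := by
    intro X Y
    by_cases hY : X = Y
    · exact ⟨(0,0), fun k => absurd hY k⟩
    · rcases hc X Y hY with k | ⟨i, j, k⟩
      · exact ⟨(df X, df Y), fun _ => Or.inl ⟨k, rfl⟩⟩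
      · exact ⟨(i, j), fun _ => Or.inr k⟩
  choose p hp using hp
  set tip : Fin 4 → Fin 4 → Fin 3 := fun X Y => if X < Y then (p X Y).1 else (p Y X).2 with htip
  have T : ∀ X Y, X ≠ Y → (P0 (v X) (w X) (v Y) (w Y) ∧ tip X Y = df X) ∨ P4 (v X) (w X) (v Y) (w Y) (tip X Y) (tip Y X) := by
    intro X Y hY
    rcases lt_or_gt_of_ne hY with k | k
    · have := hp X Y hY
      simp only [htip, if_pos k, if_neg (not_lt_of_gt k)]
      rcases this with ⟨a, b⟩ | a
      · left; exact ⟨a, by rw [b]⟩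
      · right; exact a
    · have := hp Y X hY.symm
      simp only [htip, if_pos k, if_neg (not_lt_of_gt k)]
      rcases this with ⟨a, b⟩ | a
      · left; exact ⟨a.symm, by rw [b]⟩
      · right; exact a.symm
  have TO : ∀ X Y, X ≠ Y → uu (v X) (w X) (tip X Y) = false := by
    intro X Y hY
    rcases T X Y hY with ⟨_, b⟩ | a
    · rw [b]; exact hdf X
    · exact ((h X Y hY).o4 a).1
  have N : ∀ X Y, X ≠ Y → ∀ i j, P0 (v X) (w X) (v Y) (w Y) ∨ i = tip X Y ∨ j = tip Y X → NC (v X) (v Y) i j := by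
    intro X Y hY i j hh
    rcases T X Y hY with ⟨a, _⟩ | a
    · exact (h X Y hY).nc0 a _ _
    · rcases hh with k | k | k
      · exact (h X Y hY).nc0 k _ _
      · rw [k]; exact (h X Y hY).nc4 a _
      · rw [k]; exact (h X Y hY).nc4' a _
  refine tips tip (fun X Y => P0 (v X) (w X) (v Y) (w Y)) ?_ ?_ ?_
  · intro X B C D n1 n2 n3 _ _ _
    have o4 : ∀ Y, X ≠ Y → P4 (v X) (w X) (v Y) (w Y) (tip X Y) (tip Y X) → tip X B = tip X C ∨ tip X B = tip X D ∨ tip X C = tip X D := by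
      intro Y hY k
      have := (h X Y hY).o4 k
      exact out2 _ _ _ _ _ this.1 this.2 (TO _ _ n1) (TO _ _ n2) (TO _ _ n3)
    rcases T X B n1 with ⟨_, b⟩ | a
    · rcases T X C n2 with ⟨_, b'⟩ | a
      · left; rw [b, b']
      · exact o4 C n2 a
    · exact o4 B n1 a
  · intro A D B n1 n2 n3 z1 z2 z3 e1 e2 e3
    have t1 := (T A D n1).resolve_left (fun k => z1 k.1)
    have t2 := (T A B n2).resolve_left (fun k => z2 k.1)
    have t3 := (T D B n3).resolve_left (fun k => z3 k.1)
    rw [e3] at t2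
    exact Llem (h A D n1) (h A B n2) (h D B n3) t1 t2 t3 e1 e2
  · intro A B C D n1 n2 n3 n4 n5 n6 a b c d m1 m2 m3 m4 m5 m6
    exact trv h n1 n2 n3 n4 n5 n6 (N _ _ n1 _ _ m1) (N _ _ n2 _ _ m2) (N _ _ n3 _ _ m3) (N _ _ n4 _ _ m4) (N _ _ n5 _ _ m5) (N _ _ n6 _ _ m6)

/-- dichotomy -/
lemma dich {v w : Fin 4 → Fin 3 → R2} (h : Cfg v w) {A B : Fin 4} (hAB : A ≠ B)
   (h6 : ∃ σ τ, P6 (v A) (w A) (v B) (w B) σ τ) : ∀ C, A ≠ C → ∃ σ τ, P6 (v A) (w A) (v C) (w C) σ τ := by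
  intro C hC
  obtain ⟨σ, τ, h6⟩ := h6
  have o := (h A B hAB).o6 h6
  rcases (h A C hC).cls with k | ⟨i, j, k⟩ | k
  · exact (mixed (h A C hC) k o).elim
  · have := ((h A C hC).o4 k).2
    exact absurd (by rw [o, o]) this
  · exact k
lemma all6 {v w : Fin 4 → Fin 3 → R2} (h : Cfg v w) : ∀ X Y, X ≠ Y → ∃ σ τ, P6 (v X) (w X) (v Y) (w Y) σ τ := by
  by_contra hh
  push Not at hh
  obtain ⟨X, Y, hXY, hh⟩ := hh
  apply no6 h
  intro A B hAB
  rcases (h A B hAB).cls with k | k | k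
  · exact Or.inl k
  · exact Or.inr k
  · exfalso
    have sy : ∀ {A B}, (∃ σ τ, P6 (v A) (w A) (v B) (w B) σ τ) → (∃ σ τ, P6 (v B) (w B) (v A) (w A) σ τ) := by
      rintro A B ⟨σ, τ, k⟩; exact ⟨τ, σ, k.symm⟩
    have : ∃ σ τ, P6 (v X) (w X) (v Y) (w Y) σ τ := by
      by_cases e : A = X
      · subst e; exact dich h hAB k Y hXY
      · exact dich h (Ne.symm e) (sy (dich h hAB k X e)) Y hXY
    obtain ⟨σ, τ, k⟩ := this
    exact hh σ τ k
end KW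

namespace KW

structure Stp (p q w p' q' w' : R2) : Prop where
  pp : PP p q w p' q' w'
  H : 0 < O w p q
  H' : 0 < O w' p' q'
  c1 : O p q p' < 0
  c3 : O p' q' q < 0
  c2 : 0 < O p q q'
  c4 : 0 < O p' q' p

lemma Stp.X1 {p q w p' q' w' : R2} (h : Stp p q w p' q' w') : w' = p ∨ O w p w' < 0 := by
  refine Xb h.pp.sw2 h.H h.c1 ?_
  have i1 : O q' p' p = - O p' q' p := by unfold O; ring
  have i2 : O q' p' w' = - O w' p' q' := by unfold O; ring
  rw [i1, i2]
  nlinarith [mul_pos h.c4 h.H']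
lemma rf_inj {a b : R2} (h : rf a = rf b) : a = b := by
  simp only [rf, Prod.mk.injEq, neg_inj] at h
  exact Prod.ext h.1 h.2
lemma Stp.X2 {p q w p' q' w' : R2} (h : Stp p q w p' q' w') : w = q' ∨ 0 < O w' q' w := by
  have := Xb h.pp.symm.sw1.rfl (by rw [O_rf, O_sw]; linarith [h.H']) 
    (by rw [O_rf, O_sw']; linarith [h.c3]) (by
     rw [O_rf, O_rf, O_rot w p q]; nlinarith [mul_pos h.c2 h.H])
  rcases this with k | k
  · left; exact rf_inj k
  · right; rw [O_rf] at k; linarith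

structure Nn (p q w b c z : R2) : Prop where
  pp : PP p q w b c z
  n : 0 < O p q b * O p q c
lemma Nn.symm {p q w b c z : R2} (h : Nn p q w b c z) : Nn b c z p q w := ⟨h.pp.symm, nsep h.pp h.n⟩
lemma Nn.cn {p q w b c z : R2} (h : Nn p q w b c z) (H : 0 < O w p q) : 0 < O w p z ∧ 0 < O w z q :=
  cone_in H h.pp.h1.hpq (N1 h.pp h.n) (N1' h.pp h.n)

lemma S1 {pA qA A pD qD D pC qC C : R2} (s1 : Stp pA qA A pD qD D) (s2 : Stp pD qD D pC qC C)
   (n : Nn pA qA A pC qC C) : 0 < O A D C := by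
  obtain ⟨x1, x2⟩ := n.cn s1.H
  obtain ⟨y1, y2⟩ := n.symm.cn s2.H'
  by_contra hh; push Not at hh
  have m1 := N1 n.pp n.n
  have m2 := N1' n.symm.pp n.symm.n
  have k1 : dt A D C < 0 := by
    rcases s1.X1 with e | e
    · rw [e] at hh; linarith
    · have b := baryd A pA C D A C
      have z : dt A A C = 0 := by unfold dt; ring
      rw [z, dt_comm A C pA] at b
      have : 0 < dt A C C := dt_self_pos (by rintro rfl; simp at x1)
      by_contra g; push Not at g
      nlinarith [mul_nonneg x1.le g, mul_nonneg (neg_nonneg.2 hh) m1.le, mul_pos (neg_pos.2 e) this]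
  have k2 : dt C D A < 0 := by
    have hh' : O C A D ≤ 0 := by rwa [O_rot2]
    rcases s2.X2 with e | e
    · rw [e] at hh'; linarith
    · have b := baryd C qC A D C A
      have z : dt C C A = 0 := by unfold dt; ring
      rw [z, dt_comm C A qC, O_sw C A qC, O_sw C A D] at b
      have : 0 < dt C A A := dt_self_pos (by rintro rfl; simp at y1)
      by_contra g; push Not at g
      nlinarith [mul_nonneg y2.le g, mul_nonneg (neg_nonneg.2 hh') m2.le, mul_pos e this]
  have e : dt A D C + dt C D A = (A.1-C.1)^2+(A.2-C.2)^2 := by unfold dt; ring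
  have : 0 ≤ (A.1-C.1)^2+(A.2-C.2)^2 := by positivity
  linarith

lemma S2 {p q A pD qD D pC qC C pB qB B : R2} (s1 : Stp p q A pD qD D) (s2 : Stp pB qB B p q A) 
   (n : Nn p q A pC qC C) (h1 : 0 < O A D C) (h2 : 0 < O A D B) (h3 : 0 < O A C B) : 
   dt A D B < 0 ∨ (dt A D B ≤ 0 ∧ D = p ∧ B = q) := by
  obtain ⟨x1, x2⟩ := n.cn s1.H
  have t : 0 ≤ O A D p := by
    rcases s1.X1 with e | e
    · rw [e]; simp
    · rw [O_sw]; linarith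
  have s' : 0 ≤ O A q B := by
    rcases s2.X2 with e | e
    · rw [e]; simp
    · exact e.le
  have s : 0 < O A p B := by
    have b := bary A D B p A C
    simp only [O_ab, O_sw A D C] at b
    rw [O_sw A p C] at b
    by_contra g; push Not at g
    nlinarith [mul_pos h2 x1, mul_nonneg (neg_nonneg.2 g) h1.le, mul_nonneg t h3.le]
  have t' : 0 < O A D q := by
    have b := bary A D B q A C
    simp only [O_ab, O_sw A D C] at b
    by_contra g; push Not at g
    nlinarith [mul_pos h2 x2, mul_nonneg (neg_nonneg.2 g) h3.le, mul_nonneg s' h1.le]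
  have key : O A D B * O A D B * dt A p q = O A p B * O A q B * dt A D D + O A D p * O A D q * dt A B B + 
     (O A p B * O A D q + O A D p * O A q B) * dt A D B := by unfold O dt; ring
  have hD : 0 < dt A D D := dt_self_pos (by rintro rfl; simp at h2)
  have hB : 0 < dt A B B := dt_self_pos (by rintro rfl; simp at h2)
  have c0 : 0 < O A p B * O A D q + O A D p * O A q B := by
    have := mul_pos s t'; have := mul_nonneg t s'; linarith
  have l : O A D B * O A D B * dt A p q ≤ 0 := 
    mul_nonpos_of_nonneg_of_nonpos (mul_self_nonneg _) s1.pp.h1.hpq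
  have r1 : 0 ≤ O A p B * O A q B * dt A D D := mul_nonneg (mul_nonneg s.le s') hD.le
  have r2 : 0 ≤ O A D p * O A D q * dt A B B := mul_nonneg (mul_nonneg t t'.le) hB.le
  have le : dt A D B ≤ 0 := by
    by_contra g; push Not at g
    nlinarith [mul_pos c0 g]
  rcases lt_or_eq_of_le le with g | g
  · exact Or.inl g
  right
  refine ⟨le, ?_, ?_⟩
  · rcases s1.X1 with e | e
    · exact e
    · exfalso
      have : 0 < O A D p := by rw [O_sw]; linarith
      have : 0 < O A D p * O A D q * dt A B B := by positivity
      rw [g] at key; linarith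
  · rcases s2.X2 with e | e
    · exact e
    · exfalso
      have : 0 < O A p B * O A q B * dt A D D := by positivity
      rw [g] at key; linarith

lemma fin4 {pA qA A pD qD D pC qC C pB qB B : R2} (sA : Stp pA qA A pD qD D) (sD : Stp pD qD D pC qC C)
   (sC : Stp pC qC C pB qB B) (sB : Stp pB qB B pA qA A) (n1 : Nn pA qA A pC qC C) (n2 : Nn pD qD D pB qB B) 
   (hne : pA ≠ qC) : False := by
  have oA := S1 sA sD n1
  have oD := S1 sD sC n2
  have oC := S1 sC sB n1.symm
  have oB := S1 sB sA n2.symm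
  have tA := S2 sA sB n1 oA (by rwa [O_rot2] at oB) (by rwa [O_rot] at oC)
  have tD := S2 sD sA n2 oD (by rwa [O_rot2] at oA) (by rwa [O_rot] at oB)
  have tC := S2 sC sD n1.symm oC (by rwa [O_rot2] at oD) (by rwa [O_rot] at oA)
  have tB := S2 sB sC n2.symm oB (by rwa [O_rot2] at oC) (by rwa [O_rot] at oD)
  have e : dt A D B + dt D C A + dt C B D + dt B A C = (D.1-A.1-C.1+B.1)^2+(D.2-A.2-C.2+B.2)^2 := by unfold dt; ring
  have : 0 ≤ (D.1-A.1-C.1+B.1)^2+(D.2-A.2-C.2+B.2)^2 := by positivity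
  have lA : dt A D B ≤ 0 := by rcases tA with k | k; exacts [k.le, k.1]
  have lB : dt B A C ≤ 0 := by rcases tB with k | k; exacts [k.le, k.1]
  have lC : dt C B D ≤ 0 := by rcases tC with k | k; exacts [k.le, k.1]
  have lD : dt D C A ≤ 0 := by rcases tD with k | k; exacts [k.le, k.1]
  rcases tA with k | ⟨_, k, _⟩
  · linarith
  · rcases tC with k' | ⟨_, _, k'⟩
    · linarith
    · exact hne (by rw [← k, k'])

def K6 (a b : Fin 3 → R2) (σ : Fin 3 → Fin 3) : Prop :=
  ∀ i j, (j = σ i → L a i (b j) < 0) ∧ (j ≠ σ i → 0 < L a i (b j))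

lemma mkStp {a α b β : Fin 3 → R2} {σ τ : Fin 3 → Fin 3} (h : Pr a α b β) (ka : K6 a b σ) (kb : K6 b a τ) {i j : Fin 3}
   (oa : L a i (α i) < 0) (ob : L b j (β j) < 0) (e1 : j + 1 = σ i) (e2 : i + 2 = τ j) :
   Stp (a (i+2)) (a (i+1)) (α i) (b (j+2)) (b (j+1)) (β j) := by
  have n1 : j + 2 ≠ σ i := by rw [← e1]; clear * -; revert j; decide
  have n2 : i + 1 ≠ τ j := by rw [← e2]; clear * -; revert i; decide
  have f1 := (ka i (j+1)).1 e1
  have f2 := (ka i (j+2)).2 n1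
  have f3 := (kb j (i+2)).1 e2
  have f4 := (kb j (i+1)).2 n2
  refine ⟨(h.pp i j).sw1.sw2, ?_, ?_, ?_, ?_, ?_, ?_⟩ <;> unfold L O at * <;> linarith
lemma mkNn {a α b β : Fin 3 → R2} {σ : Fin 3 → Fin 3} (h : Pr a α b β) (ka : K6 a b σ) {i j : Fin 3}
   (e1 : j = σ i) : Nn (a (i+2)) (a (i+1)) (α i) (b (j+2)) (b (j+1)) (β j) := by
  have n1 : j + 2 ≠ σ i := by rw [← e1]; clear * -; revert j; decide
  have n2 : j + 1 ≠ σ i := by rw [← e1]; clear * -; revert j; decide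
  have f1 := (ka i (j+1)).2 n2
  have f2 := (ka i (j+2)).2 n1
  refine ⟨(h.pp i j).sw1.sw2, ?_⟩
  rw [O_sw', O_sw' (a (i+1))]
  unfold L at *
  nlinarith [mul_pos f1 f2]

lemma fin6 {a α b β c γ d δ : Fin 3 → R2} (hab : Pr a α b β) (hac : Pr a α c γ) (had : Pr a α d δ) (hbc : Pr b β c γ)
   (hbd : Pr b β d δ) (hcd : Pr c γ d δ) (oa : ∀ i, L a i (α i) < 0) (ob : ∀ i, L b i (β i) < 0)
   (oc : ∀ i, L c i (γ i) < 0) (od : ∀ i, L d i (δ i) < 0)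
   (kab : K6 a b id) (kac : K6 a c id) (kad : K6 a d id) (kba : K6 b a id) (kda : K6 d a id)
   (kbc : K6 b c (· + 1)) (kbd : K6 b d (· + 1)) (kcd : K6 c d (· + 1)) (kcb : K6 c b (· + 2)) (kdc : K6 d c (· + 2)) : False := by
  have sA := mkStp had kad kda (i := 2) (j := 1) (oa _) (od _) rfl rfl
  have sD := mkStp hcd.symm kdc kcd (i := 1) (j := 2) (od _) (oc _) rfl rfl
  have sC := mkStp hbc.symm kcb kbc (i := 2) (j := 0) (oc _) (ob _) rfl rfl
  have sB := mkStp hab.symm kba kab (i := 0) (j := 2) (ob _) (oa _) rfl rfl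
  have n1 := mkNn hac kac (i := 2) (j := 2) rfl
  have n2 := (mkNn hbd kbd (i := 0) (j := 1) rfl).symm
  refine fin4 sA sD sC sB n1 n2 ?_
  intro e
  have := hac.gA 0 (2+1)
  apply this
  unfold L; rw [← e]
  show O (a 1) (a 2) (a 1) = 0
  simp

/-- orientation agreement -/
lemma same_or {a α b β : Fin 3 → R2} (h : Pr a α b β) (hs : ∀ i j, sg a i (b j) = if j = i then false else true)
    (hs' : ∀ i j, sg b i (a j) = if j = i then false else true) (ha : 0 < Dl a) : 0 < Dl b := by
  have p : ∀ i j, j ≠ i → 0 < L a i (b j) := fun i j n =>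
    pos_of_mul_pos_left (sg_t.1 (by rw [hs, if_neg n])) ha.le
  have m : ∀ i, L a i (b i) < 0 := fun i =>
    neg_of_mul_neg_left ((sg_f (h.gA _ _) h.hA).1 (by rw [hs, if_pos rfl])) ha.le
  have e : Dl a * L b 0 (a 1) = L a 2 (b 1) * L a 0 (b 2) - L a 0 (b 1) * L a 2 (b 2) := by
    simp [L, Dl, O]; ring
  have q : 0 < L b 0 (a 1) := by
    refine pos_of_mul_pos_right (a := Dl a) ?_ ha.le
    rw [e]
    nlinarith [mul_pos (p 2 1 (by decide)) (p 0 2 (by decide)), mul_pos (p 0 1 (by decide)) (neg_pos.2 (m 2))]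
  exact pos_of_mul_pos_right (sg_t.1 (by rw [hs']; rfl) : 0 < L b 0 (a 1) * Dl b) q.le

lemma f3b (i : Fin 3) : i + 2 + 2 = i + 1 := by revert i; decide
lemma f3c (i : Fin 3) : i + 1 ≠ i := by revert i; decide
lemma f3d (i : Fin 3) : i + 2 ≠ i := by revert i; decide

lemma der0 {a α b c γ : Fin 3 → R2} (hac : Pr a α c γ) (ha : 0 < Dl a)
   (kac : K6 a c id) (kba : K6 b a id) (i : Fin 3) :
   L a i (c i) * L b i (c (i+1)) - L a i (c (i+1)) * L b i (c i) < 0 := by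
  have h1 := (kac i i).1 rfl
  have h2 := (kac i (i+1)).2 (f3c i)
  have f1 := (kba i (i+1)).2 (f3c i)
  have f2 := (kba i (i+2)).2 (f3d i)
  have x := hac.cro i (i+2) (by
    rw [f3a, f3b, sg_ne (hac.gA _ _) (hac.gA _ _) hac.hA]; nlinarith)
  rw [f3a, f3b] at x
  rcases x with x | ⟨_, _, x1, x2⟩
  · linarith [x.1]
  · have e := crossId (a (i+1)) (a (i+2)) (c i) (c (i+1)) (b (i+1)) (b (i+2))
    unfold L at *
    rw [f3a, f3b] at x1 x2
    nlinarith [mul_pos (neg_pos.2 x1) f1, mul_pos x2 f2]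
lemma der {a α b β c γ : Fin 3 → R2} (hac : Pr a α c γ) (hbc : Pr b β c γ) (ha : 0 < Dl a) (hb : 0 < Dl b)
   (kac : K6 a c id) (kab : K6 a b id) (kba : K6 b a id) {σ : Fin 3 → Fin 3} (kbc : K6 b c σ) (i : Fin 3) : σ i ≠ i := by
  intro e
  have d1 := der0 hac ha kac kba i
  have h1 := (kbc i i).1 e.symm
  have h2 := (kbc i (i+1)).2 (by rw [e]; exact f3c i)
  have f1 := (kab i (i+1)).2 (f3c i)
  have f2 := (kab i (i+2)).2 (f3d i)
  have x := hbc.cro i (i+2) (by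
    rw [f3a, f3b, sg_ne (hbc.gA _ _) (hbc.gA _ _) hbc.hA]; nlinarith)
  rw [f3a, f3b] at x
  rcases x with x | ⟨_, _, x1, x2⟩
  · linarith [x.1]
  · have e := crossId (b (i+1)) (b (i+2)) (c i) (c (i+1)) (a (i+1)) (a (i+2))
    unfold L at *
    rw [f3a, f3b] at x1 x2
    nlinarith [mul_pos (neg_pos.2 x1) f1, mul_pos x2 f2]

lemma ori {a b c : Fin 3 → R2} (hb : 0 < Dl b) (kba : K6 b a id) (kbc : K6 b c (· + 1)) : 0 < O (a 0) (b 0) (c 0) := by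
  have e : Dl b * O (a 0) (b 0) (c 0) = L b 2 (a 0) * L b 1 (c 0) - L b 1 (a 0) * L b 2 (c 0) := by
    simp [L, Dl, O]; ring
  have h1 := (kba 2 0).2 (by decide)
  have h2 := (kba 1 0).2 (by decide)
  have h3 := (kbc 1 0).2 (by decide)
  have h4 := (kbc 2 0).1 (by decide)
  refine pos_of_mul_pos_right (a := Dl b) ?_ hb.le
  rw [e]; nlinarith [mul_pos h1 h3, mul_pos h2 (neg_pos.2 h4)]

lemma noCyc {a b c d : Fin 3 → R2} (kab : K6 a b id) (kac : K6 a c id) (kad : K6 a d id)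
   (h1 : 0 < O (a 0) (b 0) (c 0)) (h2 : 0 < O (a 0) (c 0) (d 0)) (h3 : 0 < O (a 0) (d 0) (b 0)) : False := by
  have e : O (a 0) (c 0) (d 0) * L a 1 (b 0) + O (a 0) (d 0) (b 0) * L a 1 (c 0) + O (a 0) (b 0) (c 0) * L a 1 (d 0) = 0 := by
    simp [L, O]; ring
  have g1 := (kab 1 0).2 (by decide)
  have g2 := (kac 1 0).2 (by decide)
  have g3 := (kad 1 0).2 (by decide)
  nlinarith [mul_pos h1 g3, mul_pos h2 g1, mul_pos h3 g2]
end KW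

namespace KW

lemma inj3 {ρ : Fin 3 → Fin 3} (h : Function.Injective ρ) (j : Fin 3) :
    (ρ (j+1) = ρ j + 1 ∧ ρ (j+2) = ρ j + 2) ∨ (ρ (j+1) = ρ j + 2 ∧ ρ (j+2) = ρ j + 1) := by
  have h1 : ρ (j+1) ≠ ρ j := fun e => absurd (h e) (by clear * -; revert j; decide)
  have h2 : ρ (j+2) ≠ ρ j := fun e => absurd (h e) (by clear * -; revert j; decide)
  have h3 : ρ (j+1) ≠ ρ (j+2) := fun e => absurd (h e) (by clear * -; revert j; decide)
  generalize ρ (j+1) = x at *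
  generalize ρ (j+2) = y at *
  generalize ρ j = z at *
  clear * - h1 h2 h3
  revert x y z; decide

lemma Pr.rperm {a α b β : Fin 3 → R2} (h : Pr a α b β) {ρ : Fin 3 → Fin 3} (hr : Function.Injective ρ) :
    Pr a α (fun j => b (ρ j)) (fun j => β (ρ j)) := by
  refine ⟨fun i j => ?_, h.hA, ?_⟩
  · rcases inj3 hr j with ⟨e1, e2⟩ | ⟨e1, e2⟩
    · simp only [e1, e2]; exact h.pp i (ρ j)
    · simp only [e1, e2]; exact (h.pp i (ρ j)).sw2
  · have hB := h.hB
    have key : ∀ z : Fin 3, O (b z) (b (z+1)) (b (z+2)) = O (b 0) (b 1) (b 2) := by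
      intro z; fin_cases z
      · rfl
      · exact O_rot _ _ _
      · exact O_rot2 _ _ _
    rcases inj3 hr 0 with ⟨e1, e2⟩ | ⟨e1, e2⟩
    · simp only [zero_add] at e1 e2
      simp only [e1, e2, key]; exact hB
    · simp only [zero_add] at e1 e2
      simp only [e1, e2]; rw [O_sw, key]; simpa using hB

lemma Pr.rfl {a α b β : Fin 3 → R2} (h : Pr a α b β) :
    Pr (fun i => rf (a i)) (fun i => rf (α i)) (fun i => rf (b i)) (fun i => rf (β i)) :=
  ⟨fun i j => (h.pp i j).rfl, by simpa [O_rf] using h.hA, by simpa [O_rf] using h.hB⟩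

lemma P6.inj {a α b β : Fin 3 → R2} {σ τ : Fin 3 → Fin 3} (h : P6 a α b β σ τ) : Function.Injective σ := by
  intro x y e
  have h1 := (h.2.2 x (σ x)).1 rfl
  have h2 := (h.2.2 y (σ x)).1 e.symm
  rw [← h1, ← h2]

lemma P6.k6 {a α b β : Fin 3 → R2} {σ τ : Fin 3 → Fin 3} (h : Pr a α b β) (h6 : P6 a α b β σ τ) (ha : 0 < Dl a) :
    K6 a b σ := by
  intro i j
  have t := h6.1 i j
  have u := h.o6 h6 i
  simp only [SS] at t
  rw [u] at t
  refine ⟨fun e => ?_, fun e => ?_⟩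
  · rw [if_pos e] at t
    exact neg_of_mul_neg_left ((sg_f (h.gA _ _) h.hA).1 t) ha.le
  · rw [if_neg e] at t
    exact pos_of_mul_pos_left (sg_t.1 t) ha.le

lemma P6.outer {a α b β : Fin 3 → R2} {σ τ : Fin 3 → Fin 3} (h : Pr a α b β) (h6 : P6 a α b β σ τ) (ha : 0 < Dl a) (i : Fin 3) :
    L a i (α i) < 0 :=
  neg_of_mul_neg_left ((sg_f (h.gw _) h.hA).1 (h.o6 h6 i)) ha.le

/-- normalised data of a pair -/
structure Nm (a α b β : Fin 3 → R2) : Prop where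
  pr : Pr a α b β
  k1 : K6 a b id
  k2 : K6 b a id
  o1 : ∀ i, L a i (α i) < 0
  o2 : ∀ i, L b i (β i) < 0
  db : 0 < Dl b

def E1 (b c : Fin 3 → R2) : Prop := K6 b c (· + 1) ∧ K6 c b (· + 2)

lemma edge {a α b β c γ : Fin 3 → R2} {σ τ : Fin 3 → Fin 3} (ha : 0 < Dl a) (nb : Nm a α b β) (nc : Nm a α c γ)
    (h : Pr b β c γ) (h6 : P6 b β c γ σ τ) : E1 b c ∨ E1 c b := by
  have k1 := h6.k6 h nb.db
  have k2 := h6.symm.k6 h.symm nc.db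
  have d := der nc.pr h ha nb.db nc.k1 nb.k1 nb.k2 k1
  have ij := h6.inj
  have it := h6.2.2
  have : (σ = (· + 1) ∧ τ = (· + 2)) ∨ (τ = (· + 1) ∧ σ = (· + 2)) := by
    have d0 := d 0
    have d1 := d 1
    have d2 := d 2
    have i1 : σ 0 ≠ σ 1 := fun e => absurd (ij e) (by decide)
    have i2 : σ 0 ≠ σ 2 := fun e => absurd (ij e) (by decide)
    have i3 : σ 1 ≠ σ 2 := fun e => absurd (ij e) (by decide)
    have t : ∀ i, τ (σ i) = i := fun i => (it i _).1 rfl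
    have c : (σ 0 = 1 ∧ σ 1 = 2 ∧ σ 2 = 0) ∨ (σ 0 = 2 ∧ σ 1 = 0 ∧ σ 2 = 1) := by
      generalize σ 0 = x at *
      generalize σ 1 = y at *
      generalize σ 2 = z at *
      clear * - d0 d1 d2 i1 i2 i3
      revert x y z; decide
    have t0 := t 0
    have t1 := t 1
    have t2 := t 2
    rcases c with ⟨c0, c1, c2⟩ | ⟨c0, c1, c2⟩
    · left
      rw [c0] at t0; rw [c1] at t1; rw [c2] at t2
      constructor <;> funext i <;> fin_cases i <;> simp [*]
    · right
      rw [c0] at t0; rw [c1] at t1; rw [c2] at t2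
      constructor <;> funext i <;> fin_cases i <;> simp [*]
  rcases this with ⟨rfl, rfl⟩ | ⟨rfl, rfl⟩
  · exact Or.inl ⟨k1, k2⟩
  · exact Or.inr ⟨k2, k1⟩

lemma tr {a α b β c γ d δ : Fin 3 → R2} (nb : Nm a α b β) (nc : Nm a α c γ) (nd : Nm a α d δ)
    (hbc : Pr b β c γ) (hbd : Pr b β d δ) (hcd : Pr c γ d δ) (e1 : E1 b c) (e2 : E1 b d) (e3 : E1 c d) : False :=
  fin6 nb.pr nc.pr nd.pr hbc hbd hcd nb.o1 nb.o2 nc.o2 nd.o2 nb.k1 nc.k1 nd.k1 nb.k2 nd.k2 e1.1 e2.1 e3.1 e1.2 e3.2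

lemma cyc {a α b β c γ d δ : Fin 3 → R2} (nb : Nm a α b β) (nc : Nm a α c γ) (nd : Nm a α d δ)
    (e1 : E1 b c) (e2 : E1 c d) (e3 : E1 d b) : False :=
  noCyc nb.k1 nc.k1 nd.k1 (ori nb.db nb.k2 e1.1) (ori nc.db nc.k2 e2.1) (ori nd.db nd.k2 e3.1)

lemma fin7 {a α b β c γ d δ : Fin 3 → R2} (nb : Nm a α b β) (nc : Nm a α c γ) (nd : Nm a α d δ)
    (hbc : Pr b β c γ) (hbd : Pr b β d δ) (hcd : Pr c γ d δ) (e1 : E1 b c ∨ E1 c b) (e2 : E1 b d ∨ E1 d b)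
    (e3 : E1 c d ∨ E1 d c) : False := by
  rcases e1 with e1 | e1 <;> rcases e2 with e2 | e2 <;> rcases e3 with e3 | e3
  · exact tr nb nc nd hbc hbd hcd e1 e2 e3
  · exact tr nb nd nc hbd hbc hcd.symm e2 e1 e3
  · exact cyc nb nc nd e1 e3 e2
  · exact tr nd nb nc hbd.symm hcd.symm hbc e2 e3 e1
  · exact tr nc nb nd hbc.symm hcd hbd e1 e3 e2
  · exact cyc nb nd nc e2 e3 e1
  · exact tr nc nd nb hcd hbc.symm hbd.symm e3 e1 e2
  · exact tr nd nc nb hcd.symm hbd.symm hbc.symm e3 e2 e1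

lemma mainId {v w : Fin 4 → Fin 3 → R2} (h : Cfg v w) (h0 : 0 < Dl (v 0))
    (hid : ∀ Y, Y ≠ 0 → ∀ i, sg (v 0) i (v Y i) = false) : False := by
  have N : ∀ Y, Y ≠ 0 → Nm (v 0) (w 0) (v Y) (w Y) := by
    intro Y hY
    have p := h 0 Y hY.symm
    obtain ⟨σ, τ, k⟩ := all6 h 0 Y hY.symm
    have es : σ = id := by
      funext i
      have t := k.1 i i
      have u := p.o6 k i
      simp only [SS] at t
      rw [u, hid Y hY] at t
      by_contra hne
      rw [if_neg (fun e => hne e.symm)] at t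
      simp at t
    have et : τ = id := by
      funext j
      have := (k.2.2 j j).1 (by rw [es]; rfl)
      exact this
    subst es et
    have s1 : ∀ i j, sg (v 0) i (v Y j) = if j = i then false else true := by
      intro i j
      have t := k.1 i j
      rw [p.o6 k i] at t
      exact t
    have s2 : ∀ i j, sg (v Y) i (v 0 j) = if j = i then false else true := by
      intro i j
      have t := k.2.1 i j
      rw [p.symm.o6 k.symm i] at t
      exact t
    have dY := same_or p s1 s2 h0
    exact ⟨p, k.k6 p h0, k.symm.k6 p.symm dY, k.outer p h0, k.symm.outer p.symm dY, dY⟩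
  have E : ∀ X Y, X ≠ 0 → Y ≠ 0 → X ≠ Y → E1 (v X) (v Y) ∨ E1 (v Y) (v X) := by
    intro X Y hX hY hXY
    obtain ⟨σ, τ, k⟩ := all6 h X Y hXY
    exact edge h0 (N X hX) (N Y hY) (h X Y hXY) k
  exact fin7 (N 1 (by decide)) (N 2 (by decide)) (N 3 (by decide)) (h 1 2 (by decide)) (h 1 3 (by decide)) (h 2 3 (by decide))
    (E 1 2 (by decide) (by decide) (by decide)) (E 1 3 (by decide) (by decide) (by decide)) (E 2 3 (by decide) (by decide) (by decide))

lemma mainPos {v w : Fin 4 → Fin 3 → R2} (h : Cfg v w) (h0 : 0 < Dl (v 0)) : False := by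
  have ex : ∀ Y : Fin 4, ∃ ρ : Fin 3 → Fin 3, Function.Injective ρ ∧ (Y = 0 → ρ = id) ∧
      (Y ≠ 0 → ∀ i, sg (v 0) i (v Y (ρ i)) = false) := by
    intro Y
    by_cases hY : Y = 0
    · exact ⟨id, Function.injective_id, fun _ => rfl, fun k => absurd hY k⟩
    · obtain ⟨σ, τ, k⟩ := all6 h 0 Y (Ne.symm hY)
      refine ⟨σ, k.inj, fun e => absurd e hY, fun _ i => ?_⟩
      have t := k.1 i (σ i)
      rw [if_pos rfl, (h 0 Y (Ne.symm hY)).o6 k i] at t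
      exact t
  choose ρ r1 r2 r3 using ex
  have e0 := r2 0 rfl
  refine mainId (v := fun Y i => v Y (ρ Y i)) (w := fun Y i => w Y (ρ Y i)) ?_ ?_ ?_
  · intro X Y hXY
    exact ((h X Y hXY).rperm (r1 Y)).symm.rperm (r1 X) |>.symm
  · simp only [e0]; exact h0
  · intro Y hY i
    have := r3 Y hY i
    simp only [e0]; exact this

theorem noCfg {v w : Fin 4 → Fin 3 → R2} (h : Cfg v w) : False := by
  have hn : Dl (v 0) ≠ 0 := (h 0 1 (by decide)).hA
  rcases lt_or_gt_of_ne hn with k | k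
  · refine mainPos (v := fun Y i => rf (v Y i)) (w := fun Y i => rf (w Y i)) (fun X Y hXY => (h X Y hXY).rfl) ?_
    simp only [Dl, O_rf] at *; linarith
  · exact mainPos h k
end KW


namespace KW

def cv (x : Pt) : R2 := (x 0, x 1)

lemma cv_inj {x y : Pt} (h : cv x = cv y) : x = y := by
  simp only [cv, Prod.mk.injEq] at h
  ext i; fin_cases i
  · exact h.1
  · exact h.2

lemma mem_disk (x a b : Pt) : x ∈ diskD a b ↔ dt (cv x) (cv a) (cv b) ≤ 0 := by
  have e : x ∈ diskD a b ↔ dist x (midpoint ℝ a b) ^ 2 ≤ (dist a b / 2) ^ 2 := by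
    rw [diskD, Metric.mem_closedBall, sq_le_sq₀ dist_nonneg (by positivity)]
  rw [e, div_pow, EuclideanSpace.dist_eq, EuclideanSpace.dist_eq, Real.sq_sqrt (by positivity), Real.sq_sqrt (by positivity)]
  simp only [Fin.sum_univ_two, Real.dist_eq, sq_abs, midpoint_eq_smul_add, PiLp.smul_apply, PiLp.add_apply, smul_eq_mul, dt, cv, invOf_eq_inv]
  constructor <;> intro h <;> nlinarith

lemma col {a b c : Pt} (hab : a ≠ b) (h : O (cv a) (cv b) (cv c) = 0) : Collinear ℝ ({a, b, c} : Set Pt) := by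
  rw [collinear_iff_of_mem (p₀ := a) (by simp)]
  have hp : 0 < dt (cv a) (cv b) (cv b) := dt_self_pos (fun e => hab (cv_inj e).symm)
  refine ⟨b - a, ?_⟩
  intro p hpm
  simp only [Set.mem_insert_iff, Set.mem_singleton_iff] at hpm
  rcases hpm with rfl | rfl | rfl
  · exact ⟨0, by simp⟩
  · exact ⟨1, by simp⟩
  · refine ⟨dt (cv a) (cv b) (cv p) / dt (cv a) (cv b) (cv b), ?_⟩
    ext i
    simp only [vadd_eq_add, PiLp.add_apply, PiLp.smul_apply, PiLp.sub_apply, smul_eq_mul]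
    rw [div_mul_eq_mul_div, ← sub_eq_iff_eq_add, eq_div_iff hp.ne']
    simp only [O, dt, cv] at *
    fin_cases i
    · simp only [Fin.zero_eta]; linear_combination (-(b 1 - a 1)) * h
    · simp only [Fin.mk_one]; linear_combination (b 0 - a 0) * h

end KW

/-- There is no witness Gabriel drawing of `K_{3,3,3,3}`. -/
theorem no_witness_gabriel_drawing_K3333 :
    ¬ ∃ (P W : Finset Pt) (c : Pt → Fin 4),
        P.card = 12 ∧
        GenPos ((P : Set Pt) ∪ (W : Set Pt)) ∧
        (∀ i : Fin 4, (P.filter (fun p => c p = i)).card = 3) ∧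
        (∀ a ∈ P, ∀ b ∈ P, a ≠ b →
          (gabrielEdge (W : Set Pt) a b ↔ c a ≠ c b)) := by
  rintro ⟨P, W, c, -, ⟨gp, -⟩, hc, hE⟩
  let e := fun X => Finset.equivFinOfCardEq (hc X)
  let v : Fin 4 → Fin 3 → Pt := fun X i => ((e X).symm i : Pt)
  have vm : ∀ X i, v X i ∈ P ∧ c (v X i) = X := by
    intro X i
    have := ((e X).symm i).2
    rwa [Finset.mem_filter] at this
  have vi : ∀ X i j, i ≠ j → v X i ≠ v X j := by
    intro X i j hij he
    exact hij ((e X).symm.injective (Subtype.ext he))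
  have vd : ∀ X Y i j, X ≠ Y → v X i ≠ v Y j := by
    intro X Y i j hXY he
    apply hXY
    rw [← (vm X i).2, ← (vm Y j).2, he]
  have n12 : ∀ i : Fin 3, i + 1 ≠ i + 2 := by decide
  have wx : ∀ X i, ∃ w ∈ W, w ∈ diskD (v X (i+1)) (v X (i+2)) ∧ w ≠ v X (i+1) ∧ w ≠ v X (i+2) := by
    intro X i
    have h := (not_congr (hE _ (vm X (i+1)).1 _ (vm X (i+2)).1 (vi X _ _ (n12 i)))).2
      (by rw [(vm X (i+1)).2, (vm X (i+2)).2]; simp)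
    rw [gabrielEdge, ← Ne, ← Set.nonempty_iff_ne_empty] at h
    obtain ⟨w, ⟨h1, h2⟩, h3⟩ := h
    simp only [Set.mem_insert_iff, Set.mem_singleton_iff, not_or] at h2
    exact ⟨w, h3, h1, h2.1, h2.2⟩
  choose w wW wd w1 w2 using wx
  have pS : ∀ X i, v X i ∈ ((P : Set Pt) ∪ (W : Set Pt)) := fun X i => Or.inl (vm X i).1
  have wS : ∀ X i, w X i ∈ ((P : Set Pt) ∪ (W : Set Pt)) := fun X i => Or.inr (wW X i)
  have acute : ∀ X Y i j k, X ≠ Y → w X i ≠ v X k → v Y j = w X i ∨ 0 < KW.dt (KW.cv (w X i)) (KW.cv (v Y j)) (KW.cv (v X k)) := by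
    intro X Y i j k hXY hk
    by_cases e : v Y j = w X i
    · exact Or.inl e
    · right
      have h := (hE _ (vm Y j).1 _ (vm X k).1 (vd _ _ _ _ hXY.symm)).2 (by rw [(vm Y j).2, (vm X k).2]; exact hXY.symm)
      by_contra hn
      rw [not_lt, ← KW.mem_disk] at hn
      have : w X i ∈ (diskD (v Y j) (v X k) \ {v Y j, v X k}) ∩ (W : Set Pt) := by
        refine ⟨⟨hn, ?_⟩, wW X i⟩
        simp only [Set.mem_insert_iff, Set.mem_singleton_iff, not_or]
        exact ⟨fun q => e q.symm, hk⟩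
      rw [gabrielEdge] at h
      rw [h] at this
      exact this
  have ob : ∀ X Y i j, X ≠ Y → KW.cv (v Y j) = KW.cv (w X i) ∨ (0 < KW.dt (KW.cv (w X i)) (KW.cv (v Y j)) (KW.cv (v X (i+1))) ∧
      0 < KW.dt (KW.cv (w X i)) (KW.cv (v Y j)) (KW.cv (v X (i+2)))) := by
    intro X Y i j hXY
    rcases acute X Y i j (i+1) hXY (w1 X i) with h | h
    · exact Or.inl (by rw [h])
    · rcases acute X Y i j (i+2) hXY (w2 X i) with h' | h'
      · exact Or.inl (by rw [h'])
      · exact Or.inr ⟨h, h'⟩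
  have pw : ∀ X Y i j, X ≠ Y → KW.PW (KW.cv (w X i)) (KW.cv (v X (i+1))) (KW.cv (v X (i+2))) (KW.cv (v Y (j+1))) (KW.cv (v Y (j+2))) := by
    intro X Y i j hXY
    exact ⟨(KW.mem_disk _ _ _).1 (wd X i),
      fun h => gp _ (wS X i) _ (pS X (i+1)) _ (pS X (i+2)) (w1 X i) (w2 X i) (vi X _ _ (n12 i)) (KW.col (w1 X i) h),
      ob X Y i _ hXY, ob X Y i _ hXY⟩
  have ng : ∀ X Y i j, X ≠ Y → KW.O (KW.cv (v X (i+1))) (KW.cv (v X (i+2))) (KW.cv (v Y j)) ≠ 0 := by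
    intro X Y i j hXY h
    exact gp _ (pS X (i+1)) _ (pS X (i+2)) _ (pS Y j) (vi X _ _ (n12 i)) (vd _ _ _ _ hXY) (vd _ _ _ _ hXY)
      (KW.col (vi X _ _ (n12 i)) h)
  have nt : ∀ X, KW.O (KW.cv (v X 0)) (KW.cv (v X 1)) (KW.cv (v X 2)) ≠ 0 := by
    intro X h
    exact gp _ (pS X 0) _ (pS X 1) _ (pS X 2) (vi X _ _ (by decide)) (vi X _ _ (by decide)) (vi X _ _ (by decide))
      (KW.col (vi X _ _ (by decide)) h)
  refine KW.noCfg (v := fun X i => KW.cv (v X i)) (w := fun X i => KW.cv (w X i)) ?_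
  intro X Y hXY
  exact ⟨fun i j => ⟨pw X Y i j hXY, pw Y X j i hXY.symm, ng X Y i _ hXY, ng X Y i _ hXY, ng Y X j _ hXY.symm, ng Y X j _ hXY.symm⟩,
    nt X, nt Y⟩
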